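/- arXiv:1708.01510 — 2 statements merged into one kernel-verified Lean document; each statement's English description precedes it below -/
import Mathlib

section
/- Let d ≥ 2 and let K be a convex body in ℝ² (a compact convex subset of the Euclidean plane with nonempty interior) — here d = 2. Then the following are equivalent: (1) for all surjective isometries φ, ψ of ℝ², whenever the intersection φ(K) ∩ ψ(K) has nonempty interior, it is centrally symmetric; (2) K is a closed disc, i.e. there exist a point c ∈ ℝ² and r > 0 with K equal to the closed ball of radius r centred at c. -/
open Metric Set

noncomputable section

/-- Euclidean `d`-space. -/
abbrev Euc (d : ℕ) := EuclideanSpace ℝ (Fin d)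

/-- A set is centrally symmetric if some point reflection `x ↦ 2c − x` maps it onto itself. -/
def CentrallySymmetric {d : ℕ} (S : Set (Euc d)) : Prop :=
  ∃ c : Euc d, (fun x => (2 : ℝ) • c - x) '' S = S

/-- An affine isometry (congruence) of Euclidean space is orientation preserving if its
linear part has determinant `1`. -/
def OrientationPreserving {d : ℕ} (φ : Euc d ≃ᵃⁱ[ℝ] Euc d) : Prop :=
  LinearMap.det (φ.linearIsometryEquiv.toLinearEquiv : Euc d →ₗ[ℝ] Euc d) = 1

/-- Condition (A): every frontier point of `K` lies on the boundary of some ball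
contained in `K`. -/
def CondA {d : ℕ} (K : Set (Euc d)) : Prop :=
  ∀ x ∈ frontier K, ∃ ε₁ : ℝ, 0 < ε₁ ∧ ∃ c : Euc d, dist x c = ε₁ ∧ closedBall c ε₁ ⊆ K

/-- `K` has an extreme point: a point of `K` not lying in the open segment joining two
distinct points of `K`. -/
def HasExtremePoint {d : ℕ} (K : Set (Euc d)) : Prop :=
  ∃ x ∈ K, ∀ y ∈ K, ∀ z ∈ K, y ≠ z → x ∉ openSegment ℝ y z

open scoped RealInnerProductSpace

/-- A convex body symmetric about the origin whose intersections with congruent copies of itself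
are centrally symmetric, the copies being described by a linear isometry and a translation. -/
structure CentredBody {d : ℕ} (K : Set (Euc d)) : Prop where
  isCompact : IsCompact K
  convex : Convex ℝ K
  neg_mem : ∀ x ∈ K, -x ∈ K
  zero_mem_interior : (0 : Euc d) ∈ interior K
  inter_symmetric : ∀ (L : Euc d ≃ₗᵢ[ℝ] Euc d) (s : Euc d),
    (interior (K ∩ {x | L (x - s) ∈ K})).Nonempty →
      CentrallySymmetric (K ∩ {x | L (x - s) ∈ K})

/-- `R • e` is a point of `K` of maximal norm, and `e` is a unit vector. -/
structure FarthestPoint {d : ℕ} (K : Set (Euc d)) (e : Euc d) (R : ℝ) : Prop where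
  norm_axis : ‖e‖ = 1
  pos : 0 < R
  mem : R • e ∈ K
  norm_le : ∀ x ∈ K, ‖x‖ ≤ R

variable {d : ℕ} {K : Set (Euc d)} {e : Euc d} {R : ℝ}

/-- A centrally symmetric set with a unique highest point `P` and a lowest point `Q` is symmetric
about the midpoint of `P` and `Q`. -/
theorem CentrallySymmetric.add_sub_mem {S : Set (Euc d)} (hS : CentrallySymmetric S)
    {v P Q : Euc d} (hP : P ∈ S) (hQ : Q ∈ S) (htop : ∀ x ∈ S, ⟪v, x⟫ ≤ ⟪v, P⟫)
    (huniq : ∀ x ∈ S, ⟪v, x⟫ = ⟪v, P⟫ → x = P) (hbot : ∀ x ∈ S, ⟪v, Q⟫ ≤ ⟪v, x⟫) :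
    ∀ x ∈ S, P + Q - x ∈ S := by
  obtain ⟨c, hc⟩ := hS
  have hmem : ∀ x ∈ S, (2 : ℝ) • c - x ∈ S := fun x hx => hc ▸ mem_image_of_mem _ hx
  have h1 := htop _ (hmem Q hQ)
  have h2 := hbot _ (hmem P hP)
  rw [inner_sub_right] at h1 h2
  have h3 := huniq _ (hmem Q hQ) (by rw [inner_sub_right]; linarith)
  intro x hx
  rw [← h3, sub_add_cancel]
  exact hmem x hx

theorem inner_smul_self_of_norm_one (he : ‖e‖ = 1) (t : ℝ) : ⟪e, t • e⟫ = t := by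
  rw [real_inner_smul_right, real_inner_self_eq_norm_sq, he]; ring

theorem inner_le_of_norm_le (he : ‖e‖ = 1) {x : Euc d} (hx : ‖x‖ ≤ R) : ⟪e, x⟫ ≤ R := by
  have := real_inner_le_norm e x
  rw [he, one_mul] at this
  exact this.trans hx

theorem eq_smul_of_inner_eq (he : ‖e‖ = 1) {x : Euc d} (hx : ‖x‖ ≤ R) (hR : 0 ≤ R)
    (h : ⟪e, x⟫ = R) : x = R • e := by
  have h1 : ‖x - R • e‖ ^ 2 ≤ 0 := by
    rw [norm_sub_sq_real, real_inner_smul_right, real_inner_comm, h, norm_smul, he,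
      Real.norm_of_nonneg hR]
    nlinarith [norm_nonneg x]
  have h2 : ‖x - R • e‖ = 0 := by nlinarith [norm_nonneg (x - R • e)]
  exact sub_eq_zero.1 (norm_eq_zero.1 h2)

theorem exists_linearIsometryEquiv_apply_eq {u v : Euc d} (h : ‖u‖ = ‖v‖) :
    ∃ L : Euc d ≃ₗᵢ[ℝ] Euc d, L u = v :=
  ⟨_, Submodule.reflection_sub h⟩

theorem LinearIsometryEquiv.inner_apply_of_apply_eq {u : Euc d} {L : Euc d ≃ₗᵢ[ℝ] Euc d}
    (h : L u = e) (x : Euc d) : ⟪e, L x⟫ = ⟪u, x⟫ := by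
  rw [← h, L.inner_map_map]

namespace CentredBody

theorem mem_closure_interior (hK : CentredBody K) {x : Euc d} (hx : x ∈ K) :
    x ∈ closure (interior K) := by
  rw [hK.convex.closure_interior_eq_closure_of_nonempty_interior ⟨0, hK.zero_mem_interior⟩]
  exact subset_closure hx

theorem exists_supporting_functional (hK : CentredBody K) {q : Euc d} (hq : q ∉ interior K) :
    ∃ f : StrongDual ℝ (Euc d), 0 < f q ∧ ∀ x ∈ K, f x ≤ f q := by
  obtain ⟨f, hf⟩ := geometric_hahn_banach_open_point hK.convex.interior isOpen_interior hq
  exact ⟨f, by simpa using hf 0 hK.zero_mem_interior, fun x hx =>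
    closure_minimal (fun y hy => (hf y hy).le) (isClosed_le f.continuous continuous_const)
      (hK.mem_closure_interior hx)⟩

theorem symmetric_inter (hK : CentredBody K) {L : Euc d ≃ₗᵢ[ℝ] Euc d} {s x : Euc d} (hx : x ∈ K)
    (hLx : L (x - s) ∈ interior K) : CentrallySymmetric (K ∩ {x | L (x - s) ∈ K}) := by
  apply hK.inter_symmetric
  have hopen : IsOpen {y | L (y - s) ∈ interior K} :=
    isOpen_interior.preimage (by fun_prop)
  obtain ⟨y, hy1, hy2⟩ := mem_closure_iff.1 (hK.mem_closure_interior hx) _ hopen hLx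
  have hsub : interior K ∩ {y | L (y - s) ∈ interior K} ⊆ K ∩ {y | L (y - s) ∈ K} :=
    fun z hz => ⟨interior_subset hz.1, interior_subset (s := K) hz.2⟩
  exact ⟨y, interior_maximal hsub (isOpen_interior.inter hopen) ⟨hy2, hy1⟩⟩

theorem zero_mem (hK : CentredBody K) : (0 : Euc d) ∈ K := interior_subset hK.zero_mem_interior

theorem smul_mem_interior (hK : CentredBody K) {x : Euc d} (hx : x ∈ K) {t : ℝ} (h0 : 0 ≤ t)
    (h1 : t < 1) : t • x ∈ interior K := by
  have := hK.convex.combo_interior_self_mem_interior hK.zero_mem_interior hx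
    (show 0 < 1 - t by linarith) h0 (by ring)
  simpa using this

theorem smul_axis_mem_interior (hK : CentredBody K) (he : FarthestPoint K e R) {t : ℝ}
    (ht : |t| < R) : t • e ∈ interior K := by
  have hR := he.pos
  have key : |t / R| < 1 := by rw [abs_div, abs_of_pos hR, div_lt_one hR]; exact ht
  rcases le_total 0 t with h | h
  · have := hK.smul_mem_interior he.mem (t := t / R) (by positivity) (abs_lt.1 key).2
    rwa [smul_smul, div_mul_cancel₀ _ hR.ne'] at this
  · have := hK.smul_mem_interior (hK.neg_mem _ he.mem) (t := -(t / R))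
      (by rw [← neg_div]; exact div_nonneg (by linarith) hR.le) (by linarith [(abs_lt.1 key).1])
    rwa [neg_smul_neg, smul_smul, div_mul_cancel₀ _ hR.ne'] at this

theorem smul_axis_mem (hK : CentredBody K) (he : FarthestPoint K e R) {t : ℝ}
    (ht : |t| ≤ R) : t • e ∈ K := by
  rcases ht.lt_or_eq with h | h
  · exact interior_subset (hK.smul_axis_mem_interior he h)
  · rcases eq_or_eq_neg_of_abs_eq h with rfl | rfl
    · exact he.mem
    · rw [neg_smul]; exact hK.neg_mem _ he.mem

/-- The body is symmetric about the line through the origin and a farthest point. -/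
theorem axis_reflection_mem (hK : CentredBody K) (he : FarthestPoint K e R) {x : Euc d}
    (hx : x ∈ K) : (2 * ⟪e, x⟫) • e - x ∈ K := by
  wlog h0 : 0 ≤ ⟪e, x⟫ generalizing x
  · have := hK.neg_mem _ (this (hK.neg_mem x hx) (by rw [inner_neg_right]; linarith))
    rw [inner_neg_right] at this
    convert this using 1
    module
  have hR := he.pos
  have hee := inner_smul_self_of_norm_one he.norm_axis
  obtain ⟨t, ht⟩ : ∃ t, ⟪e, x⟫ = t := ⟨_, rfl⟩
  rw [ht] at h0 ⊢
  have htR : t ≤ R := ht ▸ inner_le_of_norm_le he.norm_axis (he.norm_le x hx)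
  rcases htR.eq_or_lt with h | htR'
  · rw [h] at ht ⊢
    rw [eq_smul_of_inner_eq he.norm_axis (he.norm_le x hx) hR.le ht]
    convert he.mem using 1
    module
  set L := (Submodule.span ℝ {e}).reflection with hL
  have hLy : ∀ y, L y = (2 * ⟪e, y⟫) • e - y := by
    intro y
    rw [hL, Submodule.reflection_singleton_apply, he.norm_axis]
    simp [two_smul, two_mul, add_smul]
  have hLe : ∀ a : ℝ, L (a • e - (2 * t) • e) = (a - 2 * t) • e := by
    intro a
    rw [← sub_smul, hLy, hee]
    module
  have hS := hK.symmetric_inter (L := L) (s := (2 * t) • e) (x := t • e)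
    (hK.smul_axis_mem he (by rw [abs_le]; constructor <;> linarith))
    (by rw [hLe]; exact hK.smul_axis_mem_interior he (by rw [abs_lt]; constructor <;> linarith))
  have := hS.add_sub_mem (v := e) (P := R • e) (Q := (2 * t - R) • e)
    ⟨he.mem, by
      rw [mem_ofPred_eq, hLe]
      exact hK.smul_axis_mem he (by rw [abs_le]; constructor <;> linarith)⟩
    ⟨hK.smul_axis_mem he (by rw [abs_le]; constructor <;> linarith), by
      rw [mem_ofPred_eq, hLe]
      exact hK.smul_axis_mem he (by rw [abs_le]; constructor <;> linarith)⟩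
    (fun y hy => by rw [hee]; exact inner_le_of_norm_le he.norm_axis (he.norm_le y hy.1))
    (fun y hy h => eq_smul_of_inner_eq he.norm_axis (he.norm_le y hy.1) hR.le (by rw [h, hee]))
    (fun y hy => by
      have h1 := inner_le_of_norm_le he.norm_axis (he.norm_le _ (hK.neg_mem _ hy.2))
      rw [hLy, inner_neg_right, inner_sub_right, hee, inner_sub_right, hee] at h1
      rw [hee]
      linarith)
    x ⟨hx, by
      rw [mem_ofPred_eq, hLy, inner_sub_right, hee, ht]
      convert hK.neg_mem x hx using 1
      module⟩
  convert this.1 using 1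
  module

end CentredBody

theorem decompose_of_inner_eq_zero {e m : Euc 2} (he : ‖e‖ = 1) (hm : ‖m‖ ≠ 0) (hem : ⟪e, m⟫ = 0)
    (y : Euc 2) : y = ⟪e, y⟫ • e + (⟪m, y⟫ / ‖m‖ ^ 2) • m := by
  have he2 : ‖e‖ ^ 2 = 1 := by rw [he]; norm_num
  have hm2 : ‖m‖ ^ 2 ≠ 0 := pow_ne_zero 2 hm
  rw [EuclideanSpace.real_norm_sq_eq, Fin.sum_univ_two] at he2 hm2 ⊢
  simp only [PiLp.inner_apply, Fin.sum_univ_two, RCLike.inner_apply, conj_trivial] at hem ⊢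
  obtain ⟨k, h0, h1⟩ : ∃ k, m 0 = k * -e 1 ∧ m 1 = k * e 0 :=
    ⟨-(e 1 * m 0) + e 0 * m 1, by linear_combination (-m 0) * he2 + e 0 * hem,
      by linear_combination (-m 1) * he2 + e 1 * hem⟩
  rw [h0, h1] at hm2
  have hm3 : (k * -e 1) ^ 2 + (k * e 0) ^ 2 = k ^ 2 := by linear_combination k ^ 2 * he2
  rw [hm3] at hm2
  have hk : k ≠ 0 := by rintro rfl; simp at hm2
  ext i
  fin_cases i
  · simp only [Fin.zero_eta, PiLp.add_apply, PiLp.smul_apply, smul_eq_mul, h0, h1, hm3]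
    field_simp
    linear_combination (-y 0) * he2
  · simp only [Fin.mk_one, PiLp.add_apply, PiLp.smul_apply, smul_eq_mul, h0, h1, hm3]
    field_simp
    linear_combination (-y 1) * he2

/-- No side of the body is parallel to the axis through a farthest point. -/
theorem CentredBody.add_smul_mem_interior {K : Set (Euc 2)} {e m : Euc 2} {R a b : ℝ}
    (hK : CentredBody K) (he : FarthestPoint K e R) (hem : ⟪e, m⟫ = 0) (ha : m + a • e ∈ K)
    (hb : |b| < a) : m + b • e ∈ interior K := by
  have hR := he.pos
  have hee := inner_smul_self_of_norm_one he.norm_axis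
  have ha0 : 0 < a := (abs_nonneg b).trans_lt hb
  rw [abs_lt] at hb
  have haR : a ≤ R := by
    have := inner_le_of_norm_le he.norm_axis (he.norm_le _ ha)
    rwa [inner_add_right, hem, hee, zero_add] at this
  by_cases hm : m = 0
  · rw [hm, zero_add]
    exact hK.smul_axis_mem_interior he (by rw [abs_lt]; constructor <;> linarith)
  by_contra hnot
  have ha' : m + (-a) • e ∈ K := by
    have := hK.neg_mem _ (hK.axis_reflection_mem he ha)
    rw [inner_add_right, hem, hee] at this
    convert this using 1
    module
  have hmem : ∀ c, 0 ≤ c → c ≤ a → m + c • e ∈ K := by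
    intro c hc0 hca
    have := hK.convex ha ha' (a := (1 + c / a) / 2) (b := (1 - c / a) / 2) (by positivity)
      (by have := (div_le_one ha0).2 hca; linarith) (by ring)
    convert this using 1
    have : c = (c / a) * a := by field_simp
    nth_rewrite 1 [this]
    module
  have hmK : m ∈ K := by simpa using hmem 0 le_rfl ha0.le
  obtain ⟨f, hf, hfK⟩ := hK.exists_supporting_functional hnot
  have hfe : f e = 0 := by
    have h1 := hfK _ ha
    have h2 := hfK _ ha'
    simp only [map_add, map_smul, smul_eq_mul] at h1 h2
    nlinarith
  have hfm : f (m + b • e) = f m := by simp [hfe]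
  have hf0 : 0 < f m := by simpa [hfe] using hf
  obtain ⟨g, hg⟩ : ∃ g, ‖m‖ = g := ⟨_, rfl⟩
  have hg0 : 0 < g := hg ▸ norm_pos_iff.2 hm
  have hsupp : ∀ x ∈ K, ⟪m, x⟫ ≤ g ^ 2 := by
    intro x hx
    have h1 := hfK x hx
    rw [hfm, decompose_of_inner_eq_zero he.norm_axis (norm_ne_zero_iff.2 hm) hem x, hg, map_add,
      map_smul, map_smul, hfe, smul_zero, zero_add, smul_eq_mul] at h1
    have h2 : ⟪m, x⟫ / g ^ 2 ≤ 1 := by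
      by_contra! h
      nlinarith
    rwa [div_le_one (by positivity)] at h2
  set u := g⁻¹ • m with hu
  have hmu : m = g • u := by rw [hu, smul_smul, mul_inv_cancel₀ hg0.ne', one_smul]
  have hun : ‖u‖ = 1 := by
    rw [hu, norm_smul, hg, norm_inv, Real.norm_of_nonneg hg0.le, inv_mul_cancel₀ hg0.ne']
  have hue : ⟪u, e⟫ = 0 := by rw [hu, real_inner_smul_left, real_inner_comm, hem, mul_zero]
  have huu := inner_smul_self_of_norm_one hun
  have hsuppu : ∀ x ∈ K, ⟪u, x⟫ ≤ g := by
    intro x hx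
    rw [hu, real_inner_smul_left, inv_mul_le_iff₀ hg0]
    linarith [hsupp x hx]
  obtain ⟨L, hL⟩ := exists_linearIsometryEquiv_apply_eq (hun.trans he.norm_axis.symm)
  obtain ⟨ε, hε0, hεR, hεg⟩ : ∃ ε, 0 < ε ∧ ε < R ∧ ε < g :=
    ⟨min R g / 2, by positivity, by linarith [min_le_left R g], by linarith [min_le_right R g]⟩
  set s := (g - ε + R) • u with hs
  have hLm : L (m - s) ∈ interior K := by
    have : m - s = (ε - R) • u := by rw [hs, hmu]; module
    rw [this, map_smul, hL]
    exact hK.smul_axis_mem_interior he (by rw [abs_lt]; constructor <;> linarith)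
  obtain ⟨δ, hδ0, hδa, hδ⟩ : ∃ δ, 0 < δ ∧ δ ≤ a ∧ L (m + δ • e - s) ∈ K := by
    have hcont : Continuous fun δ : ℝ => L (m + δ • e - s) := by fun_prop
    have hnhds : (fun δ : ℝ => L (m + δ • e - s)) ⁻¹' interior K ∈ nhds (0 : ℝ) :=
      (isOpen_interior.preimage hcont).mem_nhds (by simpa using hLm)
    obtain ⟨η, hη, hball⟩ := Metric.mem_nhds_iff.1 hnhds
    refine ⟨min (η / 2) a, by positivity, min_le_right _ _, interior_subset (hball ?_)⟩
    rw [mem_ball_zero_iff, Real.norm_of_nonneg (by positivity)]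
    linarith [min_le_left (η / 2) a]
  have hS := hK.symmetric_inter hmK hLm
  have hPs : (g - ε) • u - s = (-R) • u := by rw [hs]; module
  have hP : (g - ε) • u ∈ K ∩ {x | L (x - s) ∈ K} := by
    refine ⟨?_, ?_⟩
    · have := hK.smul_mem_interior hmK (t := (g - ε) / g) (div_nonneg (by linarith) hg0.le)
        ((div_lt_one hg0).2 (by linarith))
      rw [hmu, smul_smul, div_mul_cancel₀ _ hg0.ne'] at this
      exact interior_subset this
    · rw [mem_ofPred_eq, hPs, map_smul, hL, neg_smul]
      exact hK.neg_mem _ he.mem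
  have hnorm : ∀ x, L (x - s) ∈ K → ‖s - x‖ ≤ R := by
    intro x hx
    rw [norm_sub_rev, ← L.norm_map]
    exact he.norm_le _ hx
  have huniq : ∀ x ∈ K ∩ {x | L (x - s) ∈ K}, ⟪-u, x⟫ = ⟪-u, (g - ε) • u⟫ → x = (g - ε) • u := by
    intro x hx h
    rw [inner_neg_left, inner_neg_left, huu] at h
    have h1 := eq_smul_of_inner_eq hun (hnorm x hx.2) hR.le
      (by rw [inner_sub_right, hs, huu]; linarith)
    have h2 : x = s - R • u := by rw [← h1]; abel
    rw [h2, hs]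
    module
  have hQ : m + δ • e ∈ K ∩ {x | L (x - s) ∈ K} := ⟨hmem δ hδ0.le hδa, hδ⟩
  have hrefl := hS.add_sub_mem (v := -u) hP ⟨hmK, interior_subset (s := K) hLm⟩
    (fun x hx => by
      have := inner_le_of_norm_le hun (hnorm x hx.2)
      rw [inner_sub_right, hs, huu] at this
      rw [inner_neg_left, inner_neg_left, huu]
      linarith)
    huniq
    (fun x hx => by
      rw [inner_neg_left, inner_neg_left, hmu, huu]
      linarith [hsuppu x hx.1])
    _ hQ
  have h1 := huniq _ hrefl (by
    simp only [inner_neg_left, inner_sub_right, inner_add_right, inner_smul_right, hue]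
    ring)
  have h2 : δ • e = 0 := by
    have : (g - ε) • u + m - (m + δ • e) = (g - ε) • u - δ • e := by abel
    rw [this] at h1
    exact sub_eq_self.1 h1
  have h3 := hee δ
  rw [h2, inner_zero_right] at h3
  exact hδ0.ne h3

theorem CentredBody.exists_inscribed_contact [Nontrivial (Euc d)] (hK : CentredBody K) :
    ∃ (r : ℝ) (e : Euc d), 0 < r ∧ ‖e‖ = 1 ∧ closedBall 0 r ⊆ K ∧ ∀ x ∈ K, ⟪e, x⟫ ≤ r := by
  have hne : (Kᶜ).Nonempty := nonempty_compl.2 hK.isCompact.ne_univ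
  obtain ⟨q, hq, hdist⟩ := isClosed_closure.exists_infDist_eq_dist hne.closure (0 : Euc d)
  rw [infDist_closure, dist_zero_left] at hdist
  rw [closure_compl] at hq
  have hball : ball 0 ‖q‖ ⊆ K := hdist ▸ ball_infDist_compl_subset
  have hq0 : ‖q‖ ≠ 0 := by
    rw [norm_ne_zero_iff]
    rintro rfl
    exact hq hK.zero_mem_interior
  have hcball : closedBall 0 ‖q‖ ⊆ K := by
    rw [← closure_ball _ hq0]
    exact closure_minimal hball hK.isCompact.isClosed
  obtain ⟨f, hf, hfK⟩ := hK.exists_supporting_functional hq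
  set v := (InnerProductSpace.toDual ℝ (Euc d)).symm f with hv
  have hfv : ∀ x, ⟪v, x⟫ = f x := fun x => InnerProductSpace.toDual_symm_apply
  have hv0 : 0 < ‖v‖ := by
    rw [norm_pos_iff]
    intro h0
    rw [← hfv, h0, inner_zero_left] at hf
    exact hf.false
  refine ⟨‖q‖, ‖v‖⁻¹ • v, by positivity, ?_, hcball, ?_⟩
  · rw [norm_smul, norm_inv, norm_norm, inv_mul_cancel₀ hv0.ne']
  · intro x hx
    rw [real_inner_smul_left, inv_mul_le_iff₀ hv0, hfv]
    exact (hfK x hx).trans (hfv q ▸ real_inner_le_norm v q)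

theorem CentredBody.exists_farthestPoint [Nontrivial (Euc d)] (hK : CentredBody K) :
    ∃ (e : Euc d) (R : ℝ), FarthestPoint K e R := by
  obtain ⟨p, hp, hmax⟩ := hK.isCompact.exists_isMaxOn ⟨0, hK.zero_mem⟩ continuous_norm.continuousOn
  obtain ⟨r, e, hr, he, hball, -⟩ := hK.exists_inscribed_contact
  have hp0 : 0 < ‖p‖ := by
    have h1 : ‖r • e‖ = r := by rw [norm_smul, he, mul_one, Real.norm_of_nonneg hr.le]
    have h2 : ‖r • e‖ ≤ ‖p‖ := hmax (hball (by rw [mem_closedBall_zero_iff, h1]))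
    linarith
  refine ⟨‖p‖⁻¹ • p, ‖p‖, ?_, hp0, ?_, fun x hx => hmax hx⟩
  · rw [norm_smul, norm_inv, norm_norm, inv_mul_cancel₀ hp0.ne']
  · rwa [smul_smul, mul_inv_cancel₀ hp0.ne', one_smul]

theorem CentredBody.eq_closedBall {K : Set (Euc 2)} (hK : CentredBody K) :
    ∃ r : ℝ, 0 < r ∧ K = closedBall 0 r := by
  obtain ⟨r, e, hr, he, hball, hsupp⟩ := hK.exists_inscribed_contact
  obtain ⟨e', R, he'⟩ := hK.exists_farthestPoint
  refine ⟨r, hr, hball.antisymm' fun x hx => mem_closedBall_zero_iff.2 ?_⟩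
  refine (he'.norm_le x hx).trans ?_
  by_contra! hrR
  have hee := inner_smul_self_of_norm_one he
  have hee' := inner_smul_self_of_norm_one he'.norm_axis
  obtain ⟨L, hL⟩ := exists_linearIsometryEquiv_apply_eq (he.trans he'.norm_axis.symm)
  have hLi := LinearIsometryEquiv.inner_apply_of_apply_eq hL
  have hre : r • e ∈ K := hball (by
    rw [mem_closedBall_zero_iff, norm_smul, he, mul_one, Real.norm_of_nonneg hr.le])
  set s := -((R - r) • e) with hs
  have hLs : ∀ x, L (x - s) = L x + (R - r) • e' := by
    intro x
    rw [hs, sub_neg_eq_add, map_add, map_smul, hL]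
  -- The copy moved so that its farthest point sits at the contact point of the inscribed ball.
  have hS : CentrallySymmetric (K ∩ {x | L (x - s) ∈ K}) :=
    hK.symmetric_inter hK.zero_mem (by
      rw [hLs, map_zero, zero_add]
      exact hK.smul_axis_mem_interior he' (by rw [abs_lt]; constructor <;> linarith))
  have hneg : ∀ x ∈ K, L (x - s) ∈ K → L (-x - s) ∈ K := by
    intro x hx hx'
    have := hS.add_sub_mem (v := e) (P := r • e) (Q := -(r • e))
      ⟨hre, by
        rw [mem_ofPred_eq, hLs, map_smul, hL, ← add_smul, add_sub_cancel]
        exact he'.mem⟩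
      ⟨hK.neg_mem _ hre, by
        rw [mem_ofPred_eq, hLs, map_neg, map_smul, hL, ← neg_smul, ← add_smul]
        exact hK.smul_axis_mem he' (by rw [abs_le]; constructor <;> linarith)⟩
      (fun y hy => by rw [hee]; exact hsupp y hy.1)
      (fun y hy h => by
        rw [hee] at h
        have h1 := eq_smul_of_inner_eq he'.norm_axis (he'.norm_le _ hy.2) he'.pos.le
          (by rw [hLs, inner_add_right, hLi, h, hee']; ring)
        rw [hLs] at h1
        apply L.injective
        rw [map_smul, hL, eq_sub_of_add_eq h1]
        module)
      (fun y hy => by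
        have := hsupp _ (hK.neg_mem y hy.1)
        rw [inner_neg_right] at this ⊢
        rw [hee]
        linarith)
      x ⟨hx, hx'⟩
    rw [add_neg_cancel, zero_sub] at this
    exact this.2
  have hLneg : ∀ x, L (-x - s) = -(L x - (R - r) • e') := by
    intro x
    rw [hLs, map_neg]
    abel
  set u := {x | L x - (R - r) • e' ∈ interior K} with hu
  have huopen : IsOpen u := isOpen_interior.preimage (by fun_prop)
  have hLu : ∀ x ∈ K, L x - (R - r) • e' ∈ K → L (x - s) ∈ K := by
    intro x hx hx'
    have := hneg (-x) (hK.neg_mem x hx) (by rw [hLneg]; exact hK.neg_mem _ hx')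
    rwa [neg_neg] at this
  set M := K ∩ {x | 0 < ⟪e, x⟫} with hM
  have hMconv : Convex ℝ M :=
    hK.convex.inter (convex_halfSpace_gt (innerSL ℝ e).isLinear 0)
  have hMu : M ⊆ u := by
    refine hMconv.isPreconnected.subset_of_closure_inter_subset huopen
      ⟨r • e, ⟨hre, by rw [mem_ofPred_eq, hee]; exact hr⟩, ?_⟩ ?_
    · rw [hu, mem_ofPred_eq, map_smul, hL, ← sub_smul]
      exact hK.smul_axis_mem_interior he' (by rw [abs_lt]; constructor <;> linarith)
    · rintro x ⟨hxu, hxK, hx0⟩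
      have hxcl : L x - (R - r) • e' ∈ K := by
        have hcl : IsClosed {x | L x - (R - r) • e' ∈ K} :=
          hK.isCompact.isClosed.preimage (by fun_prop)
        have hsub : u ⊆ {x | L x - (R - r) • e' ∈ K} := fun y hy => interior_subset (s := K) hy
        exact closure_minimal hsub hcl hxu
      have hx1 := hLu x hxK hxcl
      rw [hLs] at hx1
      rw [mem_ofPred_eq] at hx0
      have := hK.add_smul_mem_interior he' (m := L x - ⟪e, x⟫ • e') (a := ⟪e, x⟫ + (R - r))
        (b := ⟪e, x⟫ - (R - r)) (by rw [inner_sub_right, hLi, hee', sub_self])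
        (by convert hx1 using 1; module)
        (by rw [abs_lt]; constructor <;> linarith)
      rw [hu, mem_ofPred_eq]
      convert this using 1
      module
  obtain ⟨w, hwK, hwR, hw0⟩ : ∃ w ∈ K, ‖w‖ = R ∧ 0 ≤ ⟪e, w⟫ := by
    have hn : ‖R • e'‖ = R := by
      rw [norm_smul, he'.norm_axis, mul_one, Real.norm_of_nonneg he'.pos.le]
    rcases le_total 0 ⟪e, R • e'⟫ with h | h
    · exact ⟨_, he'.mem, hn, h⟩
    · exact ⟨_, hK.neg_mem _ he'.mem, by rw [norm_neg, hn], by rw [inner_neg_right]; linarith⟩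
  have hwcl : w ∈ closure M := by
    have hcont : Continuous fun t : ℝ => (1 - t) • w + t • (r • e) := by fun_prop
    have h0 : (0 : ℝ) ∈ closure (Ioo (0 : ℝ) 1) := by
      rw [closure_Ioo zero_ne_one]; exact left_mem_Icc.2 zero_le_one
    have := map_mem_closure hcont h0 (t := M) (fun t ht => ⟨hK.convex hwK hre
      (by linarith [ht.2]) ht.1.le (by ring), by
        rw [mem_ofPred_eq, inner_add_right, real_inner_smul_right, real_inner_smul_right, hee]
        have h1 := mul_pos ht.1 hr
        have h2 := mul_nonneg (sub_nonneg.2 ht.2.le) hw0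
        linarith⟩)
    simpa using this
  have hwS : L (w - s) ∈ K := by
    have hcl : IsClosed {x | L (x - s) ∈ K} := hK.isCompact.isClosed.preimage (by fun_prop)
    exact closure_minimal (fun y hy => hLu y hy.1 (interior_subset (hMu hy))) hcl hwcl
  have hfar := he'.norm_le _ hwS
  rw [L.norm_map, hs, sub_neg_eq_add] at hfar
  have hsq : ‖w + (R - r) • e‖ ^ 2 = R ^ 2 + 2 * ((R - r) * ⟪e, w⟫) + (R - r) ^ 2 := by
    rw [norm_add_sq_real, real_inner_smul_right, real_inner_comm, hwR, norm_smul, he, mul_one,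
      Real.norm_of_nonneg (by linarith)]
  have h1 : 0 < (R - r) ^ 2 := pow_pos (by linarith) 2
  have h2 : 0 ≤ (R - r) * ⟪e, w⟫ := mul_nonneg (by linarith) hw0
  have h3 := pow_le_pow_left₀ (norm_nonneg _) hfar 2
  linarith

/-- The translate of the body by its centre of symmetry is a `CentredBody`. -/
theorem exists_centredBody (hcomp : IsCompact K) (hconv : Convex ℝ K)
    (hint : (interior K).Nonempty)
    (h : ∀ φ ψ : Euc d ≃ᵢ Euc d,
      (interior (φ '' K ∩ ψ '' K)).Nonempty → CentrallySymmetric (φ '' K ∩ ψ '' K)) :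
    ∃ c : Euc d, CentredBody ((fun x => x - c) '' K) := by
  obtain ⟨c, hc⟩ : CentrallySymmetric K := by
    have hid : ⇑(IsometryEquiv.refl (Euc d)) '' K = K := image_id K
    have := h (IsometryEquiv.refl _) (IsometryEquiv.refl _)
    rw [hid, inter_self] at this
    exact this hint
  have hrefl : ∀ x ∈ K, (2 : ℝ) • c - x ∈ K := fun x hx => hc ▸ mem_image_of_mem _ hx
  have hmem : ∀ x, x ∈ (fun x => x - c) '' K ↔ x + c ∈ K := by
    intro x
    constructor
    · rintro ⟨y, hy, rfl⟩
      simpa using hy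
    · exact fun hx => ⟨x + c, hx, by simp⟩
  have hconv' : Convex ℝ ((fun x => x - c) '' K) := by
    simpa only [neg_add_eq_sub] using hconv.translate (-c)
  have hneg : ∀ x ∈ (fun x => x - c) '' K, -x ∈ (fun x => x - c) '' K := by
    intro x hx
    rw [hmem] at hx ⊢
    convert hrefl _ hx using 1
    module
  refine ⟨c, hcomp.image (by fun_prop), hconv', hneg, ?_, ?_⟩
  · obtain ⟨x, hx⟩ := hint
    have hcx : (2 : ℝ) • c - x ∈ K := hrefl x (interior_subset hx)
    have h1 : c ∈ interior K := by
      have := hconv.combo_interior_self_mem_interior hx hcx (a := 1 / 2) (b := 1 / 2)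
        (by norm_num) (by norm_num) (by norm_num)
      convert this using 1
      module
    have h2 := (IsometryEquiv.subRight c).toHomeomorph.image_interior K
    have h3 : (0 : Euc d) ∈ (IsometryEquiv.subRight c).toHomeomorph '' interior K :=
      ⟨c, h1, sub_self c⟩
    rw [h2] at h3
    exact h3
  · intro L s hS
    have key := h (IsometryEquiv.subRight c)
      ((IsometryEquiv.subRight c).trans (L.symm.toIsometryEquiv.trans (IsometryEquiv.addRight s)))
    have hset : (IsometryEquiv.subRight c) '' K ∩
        ((IsometryEquiv.subRight c).trans
          (L.symm.toIsometryEquiv.trans (IsometryEquiv.addRight s))) '' K =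
        (fun x => x - c) '' K ∩ {x | L (x - s) ∈ (fun x => x - c) '' K} := by
      congr 1
      ext x
      rw [mem_ofPred_eq]
      constructor
      · rintro ⟨y, hy, rfl⟩
        exact ⟨y, hy, by simp⟩
      · rintro ⟨y, hy, hyx⟩
        exact ⟨y, hy, by simp at hyx; simp [hyx]⟩
    rw [hset] at key
    exact key hS

theorem centrallySymmetric_closedBall_inter (a b : Euc d) (r : ℝ) :
    CentrallySymmetric (closedBall a r ∩ closedBall b r) := by
  have hmaps : ∀ x ∈ closedBall a r ∩ closedBall b r,
      a + b - x ∈ closedBall a r ∩ closedBall b r := by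
    rintro x ⟨ha, hb⟩
    rw [mem_closedBall, dist_eq_norm] at ha hb
    constructor
    · rw [mem_closedBall, dist_eq_norm, show a + b - x - a = -(x - b) by abel, norm_neg]
      exact hb
    · rw [mem_closedBall, dist_eq_norm, show a + b - x - b = -(x - a) by abel, norm_neg]
      exact ha
  refine ⟨(2 : ℝ)⁻¹ • (a + b), ?_⟩
  simp only [smul_smul, mul_inv_cancel₀ (two_ne_zero' ℝ), one_smul]
  apply Subset.antisymm
  · rintro _ ⟨x, hx, rfl⟩
    exact hmaps x hx
  · exact fun x hx => ⟨_, hmaps x hx, by simp⟩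

/-- High's theorem: a planar convex body all of whose congruent-copy intersections with
nonempty interior are centrally symmetric is a closed disc. -/
theorem high_disc_characterization (K : Set (Euc 2))
    (hKcomp : IsCompact K) (hKconv : Convex ℝ K) (hKint : (interior K).Nonempty) :
    (∀ φ ψ : Euc 2 ≃ᵢ Euc 2,
        (interior (φ '' K ∩ ψ '' K)).Nonempty → CentrallySymmetric (φ '' K ∩ ψ '' K)) ↔
    (∃ c : Euc 2, ∃ r : ℝ, 0 < r ∧ K = closedBall c r) := by
  constructor
  · intro h
    obtain ⟨c, hc⟩ := exists_centredBody hKcomp hKconv hKint h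
    obtain ⟨r, hr, hball⟩ := hc.eq_closedBall
    refine ⟨c, r, hr, ?_⟩
    ext x
    have h1 : x ∈ K ↔ x - c ∈ (fun x => x - c) '' K := by simp
    rw [h1, hball, mem_closedBall_zero_iff, mem_closedBall, dist_eq_norm]
  · rintro ⟨c, r, -, rfl⟩ φ ψ -
    rw [φ.image_closedBall, ψ.image_closedBall]
    exact centrallySymmetric_closedBall_inter _ _ r
end
end

section
/- Let d ≥ 2 and let K, L ⊆ ℝ^d be closed convex sets with nonempty interior, with K ≠ ℝ^d and L ≠ ℝ^d, both satisfying condition (A), and such that at least one of K and L has an extreme point. Then the following are equivalent: (1) there exists ε > 0 such that for all orientation-preserving surjective isometries φ, ψ of ℝ^d, if φ(K) ∩ ψ(L) has nonempty interior and diam(φ(K) ∩ ψ(L)) < ε, then φ(K) ∩ ψ(L) is centrally symmetric; (2) K and L are congruent balls, i.e. there exist r > 0 and points c, c′ with K the closed ball of radius r about c and L the closed ball of radius r about c′. -/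
open Metric Set

noncomputable section

section InnerProductSpace

variable {E : Type*} [NormedAddCommGroup E] [InnerProductSpace ℝ E]

/-- Near its point `p`, the set `K` is contained in the ball of radius `r` that passes through `p`
and has inward unit normal `e` there. -/
def LocallyInBall (K : Set E) (p e : E) (r : ℝ) : Prop :=
  ∃ δ > 0, ∀ y ∈ K, ‖y - p‖ < δ → ‖y - p‖ ^ 2 ≤ 2 * r * inner ℝ (y - p) e

/-- The vector `e` is an inward unit normal of `K` at `p`. -/
def IsInwardNormal (K : Set E) (p e : E) : Prop :=
  ‖e‖ = 1 ∧ ∀ y ∈ K, 0 ≤ inner ℝ (y - p) e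

theorem norm_sub_smul_sq {e : E} (he : ‖e‖ = 1) (y : E) (r : ℝ) :
    ‖y - r • e‖ ^ 2 = ‖y‖ ^ 2 - 2 * r * inner ℝ y e + r ^ 2 := by
  rw [norm_sub_sq_real, inner_smul_right, norm_smul, he]
  simp only [mul_one, Real.norm_eq_abs, sq_abs]
  ring

theorem mem_closedBall_add_smul_iff {e : E} (he : ‖e‖ = 1) {r : ℝ} (hr : 0 ≤ r) (p y : E) :
    y ∈ closedBall (p + r • e) r ↔ ‖y - p‖ ^ 2 ≤ 2 * r * inner ℝ (y - p) e := by
  rw [mem_closedBall, dist_eq_norm, ← sub_sub, ← abs_of_nonneg hr, ← abs_norm, ← sq_le_sq,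
    abs_of_nonneg hr, norm_sub_smul_sq he]
  constructor <;> intro h <;> linarith

/-- A ball of a convex set through a frontier point determines a normal there. -/
theorem isInwardNormal_of_closedBall_subset {L : Set E} (hL : Convex ℝ L) {q n : E}
    (hq : q ∈ frontier L) (hn : ‖n‖ = 1) {s : ℝ} (hs : 0 < s)
    (hball : closedBall (q + s • n) s ⊆ L) : IsInwardNormal L q n := by
  refine ⟨hn, fun y hy => ?_⟩
  by_contra! hneg
  have hyq : 0 < ‖y - q‖ := by
    rw [norm_pos_iff]
    rintro h
    simp [h] at hneg
  set a := inner ℝ (y - q) n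
  obtain ⟨η, hη, hlt⟩ : ∃ η > 0, η * ‖y - q‖ ^ 2 < -(2 * s * a) := by
    refine ⟨-(s * a) / ‖y - q‖ ^ 2, by apply div_pos <;> [nlinarith; positivity], ?_⟩
    rw [div_mul_cancel₀ _ (by positivity)]
    nlinarith
  have hz : q + η • (q - y) ∈ interior L := by
    refine interior_mono hball (ball_subset_interior_closedBall ?_)
    rw [mem_ball, dist_eq_norm, add_sub_add_left_eq_sub, ← abs_of_nonneg hs.le, ← abs_norm,
      ← sq_lt_sq, abs_of_nonneg hs.le, norm_sub_smul_sq hn, norm_smul, inner_smul_left,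
      ← neg_sub y q, norm_neg, inner_neg_left, Real.norm_of_nonneg hη.le]
    simp only [conj_trivial]
    change _ - 2 * s * (η * -a) + _ < _
    nlinarith
  have hq' : q ∈ openSegment ℝ (q + η • (q - y)) y := by
    refine ⟨1 / (1 + η), η / (1 + η), by positivity, by positivity, by field_simp, ?_⟩
    have h1 : (1 + η) ≠ 0 := by positivity
    rw [← smul_right_inj h1, smul_add, smul_smul, smul_smul, mul_div_cancel₀ _ h1,
      mul_div_cancel₀ _ h1]
    module
  exact hq.2 (hL.openSegment_interior_self_subset_interior hz hy hq')

theorem IsInwardNormal.eq_of_closedBall_subset {L : Set E} {q n n' : E} (hn : ‖n‖ = 1) {s : ℝ}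
    (hs : 0 < s) (hball : closedBall (q + s • n) s ⊆ L) (h' : IsInwardNormal L q n') :
    n = n' := by
  have hmem : q + s • n - s • n' ∈ L := by
    apply hball
    rw [mem_closedBall, dist_eq_norm, sub_sub_cancel_left, norm_neg, norm_smul, h'.1]
    simp [abs_of_pos hs]
  have h := h'.2 _ hmem
  rw [show q + s • n - s • n' - q = s • (n - n') by module, inner_smul_left, inner_sub_left,
    real_inner_self_eq_norm_sq, h'.1] at h
  simp only [conj_trivial] at h
  have h1 : 1 ≤ inner ℝ n n' := by nlinarith
  exact (inner_eq_one_iff_of_norm_eq_one hn h'.1).1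
    (le_antisymm (by simpa [hn, h'.1] using real_inner_le_norm n n') h1)

theorem LocallyInBall.isInwardNormal {K : Set E} (hK : Convex ℝ K) {p e : E} {r : ℝ} (hp : p ∈ K)
    (he : ‖e‖ = 1) (hr : 0 < r) (h : LocallyInBall K p e r) : IsInwardNormal K p e := by
  refine ⟨he, fun y hy => ?_⟩
  obtain ⟨δ, hδ, h⟩ := h
  obtain ⟨η, hη, hη1, hlt⟩ : ∃ η > 0, η ≤ 1 ∧ η * ‖y - p‖ < δ := by
    refine ⟨min 1 (δ / (‖y - p‖ + 1)), by positivity, min_le_left _ _, ?_⟩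
    calc _ ≤ δ / (‖y - p‖ + 1) * ‖y - p‖ := by gcongr; exact min_le_right _ _
      _ < δ := by
        rw [div_mul_eq_mul_div, div_lt_iff₀ (by positivity)]
        nlinarith
  have hmem : p + η • (y - p) ∈ K := hK.add_smul_sub_mem hp hy ⟨hη.le, hη1⟩
  have := h _ hmem (by rwa [add_sub_cancel_left, norm_smul, Real.norm_of_nonneg hη.le])
  rw [add_sub_cancel_left, inner_smul_left] at this
  simp only [conj_trivial] at this
  by_contra! hneg
  have h2 : 0 ≤ ‖η • (y - p)‖ ^ 2 := by positivity
  have : 2 * r * (η * inner ℝ (y - p) e) < 0 := by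
    have := mul_pos hr hη
    nlinarith
  linarith

/-- A convex set which is locally in a ball through `p` has small caps near `p`. -/
theorem LocallyInBall.exists_cap_small {K : Set E} (hK : Convex ℝ K) {p e : E} {r : ℝ}
    (hp : p ∈ K) (hr : 0 < r) (h : LocallyInBall K p e r) {η : ℝ}
    (hη : 0 < η) : ∃ t > 0, ∀ y ∈ K, inner ℝ (y - p) e ≤ t → ‖y - p‖ < η := by
  obtain ⟨δ, hδ, h⟩ := h
  set m := min (δ / 2) η
  have hm : 0 < m := by positivity
  refine ⟨m ^ 2 / (4 * r), by positivity, fun y hy hle => ?_⟩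
  by_contra! hge
  have hmy : m ≤ ‖y - p‖ := (min_le_right _ _).trans hge
  have hy0 : 0 < ‖y - p‖ := hm.trans_le hmy
  have hμ : m / ‖y - p‖ ≤ 1 := (div_le_one hy0).2 hmy
  have hmem : p + (m / ‖y - p‖) • (y - p) ∈ K :=
    hK.add_smul_sub_mem hp hy ⟨by positivity, hμ⟩
  have hnorm : ‖(m / ‖y - p‖) • (y - p)‖ = m := by
    rw [norm_smul, Real.norm_of_nonneg (by positivity), div_mul_cancel₀ _ hy0.ne']
  have h1 := h _ hmem (by
    rw [add_sub_cancel_left, hnorm]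
    exact (min_le_left _ _).trans_lt (by linarith))
  rw [add_sub_cancel_left, hnorm, inner_smul_left] at h1
  simp only [conj_trivial] at h1
  have h2 : 2 * r * (m / ‖y - p‖ * inner ℝ (y - p) e) ≤ 2 * r * (1 * (m ^ 2 / (4 * r))) := by
    rw [mul_le_mul_iff_right₀ (by positivity)]
    calc _ ≤ m / ‖y - p‖ * (m ^ 2 / (4 * r)) := by gcongr
      _ ≤ _ := by gcongr
  have h3 : 2 * r * (1 * (m ^ 2 / (4 * r))) = m ^ 2 / 2 := by field_simp; norm_num
  nlinarith [sq_pos_of_pos hm]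

theorem LocallyInBall.eq_of_inner_nonpos {K : Set E} (hK : Convex ℝ K) {p e : E} {r : ℝ}
    (hp : p ∈ K) (hr : 0 < r) (h : LocallyInBall K p e r) {y : E} (hy : y ∈ K)
    (hle : inner ℝ (y - p) e ≤ 0) : y = p := by
  by_contra hne
  obtain ⟨t, ht, H⟩ := h.exists_cap_small hK hp hr (norm_pos_iff.2 (sub_ne_zero.2 hne))
  exact lt_irrefl _ (H y hy (hle.trans ht.le))

theorem LocallyInBall.mem_frontier {K : Set E} (hK : Convex ℝ K) {p e : E} {r : ℝ} (hp : p ∈ K)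
    (he : ‖e‖ = 1) (hr : 0 < r) (h : LocallyInBall K p e r) : p ∈ frontier K := by
  refine ⟨subset_closure hp, fun hint => ?_⟩
  obtain ⟨δ, hδ, hsub⟩ := Metric.mem_nhds_iff.1 (mem_interior_iff_mem_nhds.1 hint)
  have hmem : p - (δ / 2) • e ∈ K := hsub (by
    rw [mem_ball, dist_eq_norm, sub_sub_cancel_left, norm_neg, norm_smul, he,
      Real.norm_of_nonneg (by positivity)]
    linarith)
  have := (h.isInwardNormal hK hp he hr).2 _ hmem
  rw [sub_sub_cancel_left, inner_neg_left, inner_smul_left, real_inner_self_eq_norm_sq, he] at this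
  simp only [conj_trivial] at this
  linarith

/-- A compact set avoiding an extreme point of `K` lies in a compact convex set avoiding it. -/
theorem exists_isCompact_convex_of_mem_extremePoints [ProperSpace E] {K A : Set E}
    (hKcl : IsClosed K) (hK : Convex ℝ K) {x : E} (hx : x ∈ K.extremePoints ℝ) (hA : IsCompact A)
    (hAK : A ⊆ K \ {x}) : ∃ C, IsCompact C ∧ Convex ℝ C ∧ A ⊆ C ∧ C ⊆ K \ {x} := by
  have hconv : Convex ℝ (K \ {x}) := (hK.mem_extremePoints_iff_convex_sdiff.1 hx).2
  refine hA.induction_on (p := fun A => ∃ C, IsCompact C ∧ Convex ℝ C ∧ A ⊆ C ∧ C ⊆ K \ {x})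
    ⟨∅, isCompact_empty, convex_empty, subset_rfl, empty_subset _⟩ ?_ ?_ ?_
  · rintro s t hst ⟨C, h1, h2, h3, h4⟩
    exact ⟨C, h1, h2, hst.trans h3, h4⟩
  · rintro s t ⟨C, hCc, hC, hsC, hCK⟩ ⟨D, hDc, hD, htD, hDK⟩
    rcases C.eq_empty_or_nonempty with rfl | hCne
    · exact ⟨D, hDc, hD, union_subset (hsC.trans (empty_subset _)) htD, hDK⟩
    rcases D.eq_empty_or_nonempty with rfl | hDne
    · exact ⟨C, hCc, hC, union_subset hsC (htD.trans (empty_subset _)), hCK⟩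
    refine ⟨convexJoin ℝ C D, ?_, hC.convexJoin hD,
      union_subset (hsC.trans (subset_convexJoin_left hDne))
        (htD.trans (subset_convexJoin_right hCne)), convexJoin_subset hCK hDK hconv⟩
    have : convexJoin ℝ C D =
        (fun z : ℝ × E × E => z.2.1 + z.1 • (z.2.2 - z.2.1)) '' (Icc 0 1 ×ˢ C ×ˢ D) := by
      ext y
      simp only [mem_convexJoin, segment_eq_image', mem_image, mem_prod, Prod.exists]
      constructor
      · rintro ⟨a, ha, b, hb, θ, hθ, rfl⟩
        exact ⟨θ, a, b, ⟨hθ, ha, hb⟩, rfl⟩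
      · rintro ⟨θ, a, b, ⟨hθ, ha, hb⟩, rfl⟩
        exact ⟨a, ha, b, hb, θ, hθ, rfl⟩
    rw [this]
    exact (isCompact_Icc.prod (hCc.prod hDc)).image (by fun_prop)
  · intro a ha
    have hax : 0 < dist x a := dist_pos.2 fun h => (hAK ha).2 h.symm
    refine ⟨A ∩ closedBall a (dist x a / 2), Filter.inter_mem self_mem_nhdsWithin
      (mem_nhdsWithin_of_mem_nhds (closedBall_mem_nhds _ (by positivity))),
      K ∩ closedBall a (dist x a / 2), (isCompact_closedBall _ _).inter_left hKcl,
      hK.inter (convex_closedBall _ _), inter_subset_inter_left _ (hAK.trans sdiff_subset), ?_⟩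
    rintro y ⟨hy, hya⟩
    refine ⟨hy, ?_⟩
    rintro rfl
    rw [mem_closedBall] at hya
    linarith

/-- A closed convex set with an extreme point has a point at which it is locally in a ball. -/
theorem exists_locallyInBall_of_mem_extremePoints [FiniteDimensional ℝ E] {K : Set E}
    (hKcl : IsClosed K) (hK : Convex ℝ K) {x z : E} (hx : x ∈ K.extremePoints ℝ) (hz : z ∈ K)
    (hzx : z ≠ x) : ∃ p ∈ K, ∃ e : E, ‖e‖ = 1 ∧ ∃ r > 0, LocallyInBall K p e r := by
  set η := ‖z - x‖
  have hη : 0 < η := norm_pos_iff.2 (sub_ne_zero.2 hzx)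
  obtain ⟨C, hCc, hC, hAC, hCK⟩ := exists_isCompact_convex_of_mem_extremePoints hKcl hK hx
    ((isCompact_sphere x η).inter_left hKcl) (by
      rintro y ⟨hy, hyx⟩
      refine ⟨hy, ?_⟩
      rintro rfl
      simp [hη.ne] at hyx)
  obtain ⟨f, s, hfx, hfC⟩ := geometric_hahn_banach_point_closed hC hCc.isClosed
    fun h => (hCK h).2 rfl
  have hzC : z ∈ C := hAC ⟨hz, by simp [η]⟩
  obtain ⟨w, hw⟩ : ∃ w : E, ∀ y, f y = inner ℝ w y :=
    ⟨(InnerProductSpace.toDual ℝ E).symm f, fun y => by simp⟩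
  have hw0 : 0 < ‖w‖ := by
    rw [norm_pos_iff]
    rintro rfl
    have := hfC z hzC
    simp only [hw, inner_zero_left] at this hfx
    linarith
  have hxK := extremePoints_subset hx
  have hcap : ∀ y ∈ K, f y ≤ s → ‖y - x‖ ≤ η := by
    intro y hy hys
    by_contra! hlt
    have hy0 : 0 < ‖y - x‖ := hη.trans hlt
    have hμ : η / ‖y - x‖ ≤ 1 := (div_le_one hy0).2 hlt.le
    have hμ0 : 0 ≤ η / ‖y - x‖ := by positivity
    have hmem : x + (η / ‖y - x‖) • (y - x) ∈ C := by
      refine hAC ⟨hK.add_smul_sub_mem hxK hy ⟨hμ0, hμ⟩, ?_⟩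
      rw [mem_sphere, dist_eq_norm, add_sub_cancel_left, norm_smul, Real.norm_of_nonneg hμ0,
        div_mul_cancel₀ _ hy0.ne']
    have := hfC _ hmem
    rw [map_add, map_smul, map_sub, smul_eq_mul] at this
    nlinarith
  set T := (η ^ 2 + 1) / (2 * (s - f x))
  have hT : 0 < T := by have := sub_pos.2 hfx; positivity
  set c := x + T • w
  have hcpt : IsCompact (K ∩ {y | f y ≤ s}) := by
    refine (isCompact_closedBall x η).of_isClosed_subset
      (hKcl.inter (isClosed_le f.continuous continuous_const)) ?_
    rintro y ⟨hy, hys⟩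
    rw [mem_closedBall, dist_eq_norm]
    exact hcap y hy hys
  obtain ⟨p, ⟨hpK, hps⟩, hmax⟩ := hcpt.exists_isMaxOn ⟨x, hxK, hfx.le⟩
    (f := fun y => ‖y - c‖) (by fun_prop)
  have hmax' : ∀ y ∈ K, f y ≤ s → ‖y - c‖ ≤ ‖p - c‖ := fun y hy hys => hmax ⟨hy, hys⟩
  have hxc : 0 < ‖x - c‖ := by
    simp only [c, sub_add_cancel_left, norm_neg, norm_smul, Real.norm_of_nonneg hT.le]
    positivity
  have hpc : 0 < ‖p - c‖ := hxc.trans_le (hmax' x hxK hfx.le)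
  have hps' : f p < s := by
    refine lt_of_le_of_ne hps fun heq => ?_
    have h1 := hmax' x hxK hfx.le
    rw [← sq_le_sq₀ (norm_nonneg _) (norm_nonneg _)] at h1
    have h2 := hcap p hpK hps
    rw [← sq_le_sq₀ (norm_nonneg _) (norm_nonneg _)] at h2
    have h3 : ‖p - c‖ ^ 2 = ‖p - x‖ ^ 2 - 2 * T * (s - f x) + ‖x - c‖ ^ 2 := by
      rw [← heq, hw, hw, ← inner_sub_right, show p - c = (p - x) - T • w by simp [c, sub_sub],
        show x - c = -(T • w) by simp [c], norm_neg, norm_sub_sq_real, inner_smul_right,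
        real_inner_comm]
      ring
    have h4 : 2 * T * (s - f x) = η ^ 2 + 1 := by
      have : s - f x ≠ 0 := (sub_pos.2 hfx).ne'
      simp only [T]
      field_simp
    linarith
  obtain ⟨δ, hδ, hball⟩ := Metric.mem_nhds_iff.1
    ((isOpen_lt f.continuous continuous_const).mem_nhds (show p ∈ {y | f y < s} from hps'))
  have he : ‖‖p - c‖⁻¹ • (c - p)‖ = 1 := by
    rw [norm_smul, norm_inv, norm_norm, norm_sub_rev c p, inv_mul_cancel₀ hpc.ne']
  refine ⟨p, hpK, ‖p - c‖⁻¹ • (c - p), he, ‖p - c‖, hpc, δ, hδ, fun y hy hyp => ?_⟩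
  rw [← mem_closedBall_add_smul_iff he hpc.le, smul_inv_smul₀ hpc.ne', add_sub_cancel,
    mem_closedBall, dist_eq_norm]
  exact hmax' y hy (le_of_lt (hball (by rwa [mem_ball, dist_eq_norm])))

theorem norm_smul_add_smul_sq {u w : E} (hu : ‖u‖ = 1) (hw : ‖w‖ = 1) (huw : inner ℝ u w = 0)
    (a b : ℝ) : ‖a • u + b • w‖ ^ 2 = a ^ 2 + b ^ 2 := by
  rw [norm_add_sq_real, inner_smul_left, inner_smul_right, huw, norm_smul, norm_smul, hu, hw]
  simp

/-- A set which contains a circular arc with midpoint `x`, centre `x - V`, cannot be locally in a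
ball of radius less than `‖V‖` at `x`. -/
theorem LocallyInBall.norm_le_of_arc {L : Set E} {x n V V' : E} {r : ℝ}
    (h : LocallyInBall L x n r) (hn : ‖n‖ = 1) (hr : 0 < r) (hV : ‖V'‖ = ‖V‖)
    (hVV' : inner ℝ V V' = 0)
    (harc : ∀ᶠ τ in nhds (0 : ℝ), x + ((Real.cos τ - 1) • V + Real.sin τ • V') ∈ L) :
    ‖V‖ ≤ r := by
  obtain ⟨δ, hδ, hball⟩ := h
  have hsmall : ∀ᶠ τ in nhds (0 : ℝ), ‖(Real.cos τ - 1) • V + Real.sin τ • V'‖ < δ := by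
    refine ContinuousAt.eventually_lt (by fun_prop) (by fun_prop) ?_
    simpa using hδ
  have hstep : ∀ τ, x + ((Real.cos τ - 1) • V + Real.sin τ • V') ∈ L →
      ‖(Real.cos τ - 1) • V + Real.sin τ • V'‖ < δ →
      2 * (1 - Real.cos τ) * ‖V‖ ^ 2 ≤
        2 * r * ((Real.cos τ - 1) * inner ℝ V n + Real.sin τ * inner ℝ V' n) := by
    intro τ h1 h2
    have h3 := hball _ h1 (by rwa [add_sub_cancel_left])
    rw [add_sub_cancel_left, inner_add_left, inner_smul_left, inner_smul_left, norm_add_sq_real,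
      inner_smul_left, inner_smul_right, hVV', norm_smul, norm_smul, hV, mul_pow, mul_pow,
      Real.norm_eq_abs, Real.norm_eq_abs, sq_abs, sq_abs] at h3
    simp only [conj_trivial] at h3
    refine le_trans (le_of_eq ?_) h3
    linear_combination -‖V‖ ^ 2 * Real.sin_sq_add_cos_sq τ
  obtain ⟨η, hη, hτ⟩ := Metric.eventually_nhds_iff.1 (harc.and hsmall)
  obtain ⟨τ, hτ0, hτ1, hτη⟩ : ∃ τ : ℝ, 0 < τ ∧ τ ≤ 1 ∧ τ < η :=
    ⟨min (η / 2) 1, by positivity, min_le_right _ _, (min_le_left _ _).trans_lt (by linarith)⟩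
  obtain ⟨p1, p2⟩ := hτ (y := τ) (by simpa [abs_of_pos hτ0] using hτη)
  obtain ⟨q1, q2⟩ := hτ (y := -τ) (by simpa [abs_of_pos hτ0] using hτη)
  have hp := hstep _ p1 p2
  have hq := hstep _ q1 q2
  rw [Real.cos_neg, Real.sin_neg] at hq
  have hcos : Real.cos τ < 1 := by
    have := Real.cos_lt_cos_of_nonneg_of_le_pi le_rfl
      (show τ ≤ Real.pi by linarith [Real.pi_gt_three]) hτ0
    simpa using this
  have hCS : -inner ℝ V n ≤ ‖V‖ := by
    have := abs_real_inner_le_norm V n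
    rw [hn, mul_one] at this
    linarith [(abs_le.1 this).1]
  have h1 : (1 - Real.cos τ) * ‖V‖ ^ 2 ≤ (1 - Real.cos τ) * (r * -inner ℝ V n) := by
    linarith
  have h2 : ‖V‖ ^ 2 ≤ r * ‖V‖ :=
    (le_of_mul_le_mul_left h1 (sub_pos.2 hcos)).trans (by gcongr)
  by_contra! hlt
  nlinarith

/-- Suppose that `L` is locally in a ball of radius `r` at every frontier point. In a plane through
two interior points of `L`, consider the segment cut off by their chord, on the side of `w`, from
the circle through them with centre at height `-h`. It lies in the interior of `L` if all circles
through the two points with centre at height at most `-h` have radius larger than `r`. -/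
theorem circularSegment_subset_interior {L : Set E} (hLcl : IsClosed L) (hL : Convex ℝ L) {r : ℝ}
    (hr : 0 < r) (hloc : ∀ q ∈ frontier L, ∃ n : E, ‖n‖ = 1 ∧ LocallyInBall L q n r)
    {m u w : E} (hu : ‖u‖ = 1) (hw : ‖w‖ = 1) (huw : inner ℝ u w = 0) {l h : ℝ} (hl : 0 < l)
    (h₁ : m - l • u ∈ interior L) (h₂ : m + l • u ∈ interior L) (hrad : r ^ 2 < max h 0 ^ 2 + l ^ 2)
    {s z : ℝ} (hz : 0 ≤ z) (hsz : s ^ 2 + z ^ 2 + 2 * h * z ≤ l ^ 2) :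
    m + s • u + z • w ∈ interior L := by
  by_contra hnot
  set G : Set (ℝ × ℝ) := {x | (0 ≤ x.2 ∧ x.1 ^ 2 + x.2 ^ 2 + 2 * h * x.2 ≤ l ^ 2) ∧
    m + x.1 • u + x.2 • w ∈ (interior L)ᶜ} with hG
  have hGcl : IsClosed G := by
    have h1 : IsClosed {x : ℝ × ℝ | 0 ≤ x.2} := isClosed_le (by fun_prop) (by fun_prop)
    have h2 : IsClosed {x : ℝ × ℝ | x.1 ^ 2 + x.2 ^ 2 + 2 * h * x.2 ≤ l ^ 2} :=
      isClosed_le (by fun_prop) (by fun_prop)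
    have h3 : IsClosed {x : ℝ × ℝ | m + x.1 • u + x.2 • w ∈ (interior L)ᶜ} :=
      isOpen_interior.isClosed_compl.preimage (by fun_prop)
    exact (h1.inter h2).inter h3
  have hGcpt : IsCompact G := by
    refine (isCompact_Icc (a := ((-(|h| + l), -h - (|h| + l)) : ℝ × ℝ))
      (b := (|h| + l, -h + (|h| + l)))).of_isClosed_subset hGcl ?_
    rintro ⟨s, z⟩ ⟨⟨-, h2⟩, -⟩
    have hM : l ^ 2 + h ^ 2 ≤ (|h| + l) ^ 2 := by
      have := mul_nonneg (abs_nonneg h) hl.le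
      nlinarith [sq_abs h]
    have hM0 : 0 ≤ |h| + l := by positivity
    have ha := abs_le.1 (abs_le_of_sq_le_sq
      (show s ^ 2 ≤ (|h| + l) ^ 2 by nlinarith [sq_nonneg (z + h)]) hM0)
    have hb := abs_le.1 (abs_le_of_sq_le_sq
      (show (z + h) ^ 2 ≤ (|h| + l) ^ 2 by nlinarith [sq_nonneg s]) hM0)
    refine ⟨⟨ha.1, ?_⟩, ⟨ha.2, ?_⟩⟩ <;> dsimp only <;> linarith [hb.1, hb.2]
  have hpos : ∀ x ∈ G, 0 < x.2 := by
    rintro ⟨s, z⟩ ⟨⟨h1, h2⟩, h3⟩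
    refine lt_of_le_of_ne h1 ?_
    rintro rfl
    refine h3 ?_
    obtain ⟨hs1, hs2⟩ := abs_le.1 (abs_le_of_sq_le_sq (show s ^ 2 ≤ l ^ 2 by simpa using h2) hl.le)
    have := hL.interior.add_smul_sub_mem h₁ h₂ (t := (s + l) / (2 * l))
      ⟨by apply div_nonneg <;> linarith, by rw [div_le_one (by positivity)]; linarith⟩
    convert this using 1
    rw [show m + l • u - (m - l • u) = (2 * l) • u by module, smul_smul,
      div_mul_cancel₀ _ (by positivity)]
    module
  obtain ⟨⟨s₁, z₁⟩, hx₁, hmax⟩ := hGcpt.exists_isMaxOn ⟨(s, z), ⟨hz, hsz⟩, hnot⟩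
    (f := fun x => (l ^ 2 - x.1 ^ 2 - x.2 ^ 2) / (2 * x.2))
    (ContinuousOn.div (by fun_prop) (by fun_prop) fun x hx => by have := hpos x hx; positivity)
  have hz₁ : 0 < z₁ := hpos _ hx₁
  set k := (l ^ 2 - s₁ ^ 2 - z₁ ^ 2) / (2 * z₁) with hk
  have hkz : s₁ ^ 2 + z₁ ^ 2 + 2 * k * z₁ = l ^ 2 := by
    rw [hk]; field_simp; ring
  have hhk : h ≤ k := by
    have := hx₁.1.2
    rw [← hkz] at this
    dsimp only at this
    nlinarith
  have hint : ∀ s z : ℝ, 0 < z → s ^ 2 + z ^ 2 + 2 * k * z < l ^ 2 →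
      m + s • u + z • w ∈ interior L := by
    intro s z hz hlt
    by_contra hn
    have : (s, z) ∈ G := ⟨⟨hz.le, by dsimp only; nlinarith⟩, hn⟩
    have := hmax this
    simp only [mem_ofPred_eq] at this
    rw [div_le_iff₀ (by positivity)] at this
    linarith
  have hmemL : ∀ s z : ℝ, 0 < z → s ^ 2 + z ^ 2 + 2 * k * z ≤ l ^ 2 →
      m + s • u + z • w ∈ L := by
    intro s z hz hle
    have hclosed : IsClosed {θ : ℝ | m + (θ * s) • u + (θ * z) • w ∈ L} :=
      hLcl.preimage (by fun_prop)
    have hsub : Ioo (0 : ℝ) 1 ⊆ {θ : ℝ | m + (θ * s) • u + (θ * z) • w ∈ L} := by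
      rintro θ ⟨hθ0, hθ1⟩
      refine interior_subset (s := L) (hint (θ * s) (θ * z) (by positivity) ?_)
      have h1 : θ * (s ^ 2 + z ^ 2 + 2 * k * z) ≤ θ * l ^ 2 := by gcongr
      have h2 : 0 < θ * (1 - θ) * (s ^ 2 + z ^ 2) := by
        have := sub_pos.2 hθ1
        positivity
      have h3 : 0 < (1 - θ) * l ^ 2 := by
        have := sub_pos.2 hθ1
        positivity
      nlinarith
    have h1 : (1 : ℝ) ∈ closure (Ioo (0 : ℝ) 1) := by
      rw [closure_Ioo zero_ne_one]
      simp
    simpa using closure_minimal hsub hclosed h1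
  have hxL := hmemL s₁ z₁ hz₁ hkz.le
  obtain ⟨n, hn, hx⟩ := hloc _ ⟨subset_closure hxL, hx₁.2⟩
  have hVn : ‖s₁ • u + (z₁ + k) • w‖ ^ 2 = s₁ ^ 2 + (z₁ + k) ^ 2 :=
    norm_smul_add_smul_sq hu hw huw _ _
  have hle : ‖s₁ • u + (z₁ + k) • w‖ ≤ r := by
    refine hx.norm_le_of_arc hn hr (V' := (-(z₁ + k)) • u + s₁ • w) ?_ ?_ ?_
    · rw [← sq_eq_sq₀ (norm_nonneg _) (norm_nonneg _), hVn, norm_smul_add_smul_sq hu hw huw]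
      ring
    · simp only [inner_add_left, inner_add_right, inner_smul_left, inner_smul_right, huw,
        real_inner_comm u w, real_inner_self_eq_norm_sq, hu, hw, conj_trivial]
      ring
    · have hev : ∀ᶠ τ in nhds (0 : ℝ),
          0 < z₁ + ((z₁ + k) * (Real.cos τ - 1) + s₁ * Real.sin τ) := by
        refine ContinuousAt.eventually_lt (by fun_prop) (by fun_prop) ?_
        simpa using hz₁
      filter_upwards [hev] with τ hτ
      convert hmemL (s₁ + (s₁ * (Real.cos τ - 1) - (z₁ + k) * Real.sin τ)) _ hτ (by
        refine le_of_eq ?_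
        rw [← hkz]
        linear_combination (s₁ ^ 2 + (z₁ + k) ^ 2) * Real.sin_sq_add_cos_sq τ) using 1
      module
  have hsq : ‖s₁ • u + (z₁ + k) • w‖ ^ 2 ≤ r ^ 2 := by gcongr
  have hmk : max h 0 ^ 2 ≤ k ^ 2 := by
    rcases le_total h 0 with h0 | h0
    · rw [max_eq_right h0, zero_pow two_ne_zero]
      positivity
    · rw [max_eq_left h0]
      gcongr
  rw [hVn] at hsq
  linarith

theorem circularSegment_subset {L : Set E} (hLcl : IsClosed L) (hL : Convex ℝ L)
    (hLint : (interior L).Nonempty) {r : ℝ} (hr : 0 < r)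
    (hloc : ∀ q ∈ frontier L, ∃ n : E, ‖n‖ = 1 ∧ LocallyInBall L q n r)
    {m u w : E} (hu : ‖u‖ = 1) (hw : ‖w‖ = 1) (huw : inner ℝ u w = 0) {l h : ℝ} (hl : 0 < l)
    (h₁ : m - l • u ∈ L) (h₂ : m + l • u ∈ L) (hrad : r ^ 2 < max h 0 ^ 2 + l ^ 2)
    {s z : ℝ} (hz : 0 ≤ z) (hsz : s ^ 2 + z ^ 2 + 2 * h * z < l ^ 2) :
    m + s • u + z • w ∈ L := by
  obtain ⟨o, ho⟩ := hLint
  have hev : ∀ᶠ η in nhds (0 : ℝ), r ^ 2 < max h 0 ^ 2 + ((1 - η) * l) ^ 2 ∧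
      s ^ 2 + z ^ 2 + 2 * h * z < ((1 - η) * l) ^ 2 ∧ η < 1 := by
    refine .and ?_ (.and ?_ (eventually_lt_nhds one_pos))
    · exact ContinuousAt.eventually_lt (by fun_prop) (by fun_prop) (by simpa using hrad)
    · exact ContinuousAt.eventually_lt (by fun_prop) (by fun_prop) (by simpa using hsz)
  refine hLcl.mem_of_tendsto (b := nhdsWithin (0 : ℝ) (Ioi 0))
    (f := fun η => ((1 - η) • m + η • o) + s • u + z • w) ?_ ?_
  · refine Filter.Tendsto.mono_left ?_ nhdsWithin_le_nhds
    have : Continuous fun η : ℝ => ((1 - η) • m + η • o) + s • u + z • w := by fun_prop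
    simpa using this.tendsto 0
  · filter_upwards [nhdsWithin_le_nhds hev, self_mem_nhdsWithin] with η ⟨e1, e2, e3⟩ e0
    have e0 : 0 < η := e0
    have hη := sub_pos.2 e3
    refine interior_subset (circularSegment_subset_interior hLcl hL hr hloc hu hw huw
      (by positivity : 0 < (1 - η) * l) ?_ ?_ e1 hz e2.le)
    · convert hL.combo_self_interior_mem_interior h₁ ho hη.le e0 (by ring) using 1
      module
    · convert hL.combo_self_interior_mem_interior h₂ ho hη.le e0 (by ring) using 1
      module

theorem exists_norm_eq_one_inner_eq_zero [FiniteDimensional ℝ E] (hd : 2 ≤ Module.finrank ℝ E)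
    (u : E) : ∃ w : E, ‖w‖ = 1 ∧ inner ℝ u w = 0 := by
  have hne : (ℝ ∙ u)ᗮ ≠ ⊥ := by
    intro h
    have h1 := Submodule.finrank_add_finrank_orthogonal (ℝ ∙ u)
    rw [h, finrank_bot] at h1
    have h2 := finrank_span_le_card (R := ℝ) ({u} : Set E)
    simp only [toFinset_singleton, Finset.card_singleton] at h2
    omega
  obtain ⟨v, hv, hv0⟩ := Submodule.exists_mem_ne_zero_of_ne_bot hne
  refine ⟨‖v‖⁻¹ • v, norm_smul_inv_norm hv0, ?_⟩
  rw [inner_smul_right, Submodule.mem_orthogonal_singleton_iff_inner_right.1 hv, mul_zero]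

theorem exists_orthogonal_decomposition [FiniteDimensional ℝ E] (hd : 2 ≤ Module.finrank ℝ E)
    {u n : E} (hu : ‖u‖ = 1) : ∃ w : E, ∃ σ : ℝ, ‖w‖ = 1 ∧ inner ℝ u w = 0 ∧ 0 ≤ σ ∧
      n = inner ℝ u n • u - σ • w := by
  set v := inner ℝ u n • u - n with hv
  by_cases hv0 : v = 0
  · obtain ⟨w, hw, huw⟩ := exists_norm_eq_one_inner_eq_zero hd u
    exact ⟨w, 0, hw, huw, le_rfl, by rw [zero_smul, sub_zero]; exact (sub_eq_zero.1 hv0).symm⟩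
  · refine ⟨‖v‖⁻¹ • v, ‖v‖, norm_smul_inv_norm hv0, ?_, norm_nonneg _, ?_⟩
    · rw [inner_smul_right, hv, inner_sub_right, inner_smul_right, real_inner_self_eq_norm_sq, hu]
      ring
    · rw [smul_inv_smul₀ (norm_ne_zero_iff.2 hv0), hv]
      abel

/-- **Blaschke's rolling theorem**: a closed convex set which is locally in a ball of radius `r` at
every frontier point is globally contained in these balls. -/
theorem norm_sub_sq_le_of_locallyInBall [FiniteDimensional ℝ E] (hd : 2 ≤ Module.finrank ℝ E)
    {L : Set E} (hLcl : IsClosed L) (hL : Convex ℝ L) (hLint : (interior L).Nonempty) {r : ℝ}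
    (hr : 0 < r) (hloc : ∀ q ∈ frontier L, ∃ n : E, ‖n‖ = 1 ∧ LocallyInBall L q n r)
    {q n y : E} (hq : q ∈ L) (hn : IsInwardNormal L q n) (hy : y ∈ L) :
    ‖y - q‖ ^ 2 ≤ 2 * r * inner ℝ (y - q) n := by
  by_cases hyq : y = q
  · simp [hyq]
  have hy0 : 0 < ‖y - q‖ := norm_pos_iff.2 (sub_ne_zero.2 hyq)
  set l := ‖y - q‖ / 2 with hl
  have hl0 : 0 < l := by positivity
  obtain ⟨u, hu1, hyu⟩ : ∃ u : E, ‖u‖ = 1 ∧ y - q = (2 * l) • u :=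
    ⟨‖y - q‖⁻¹ • (y - q), norm_smul_inv_norm (sub_ne_zero.2 hyq), by
      rw [hl, mul_div_cancel₀ _ two_ne_zero, smul_inv_smul₀ hy0.ne']⟩
  obtain ⟨w, σ, hw, huw, hσ, hdec⟩ := exists_orthogonal_decomposition hd (n := n) hu1
  set c := inner ℝ u n with hc
  have hc0 : 0 ≤ c := by
    have := hn.2 y hy
    rw [hyu, inner_smul_left] at this
    simp only [conj_trivial] at this
    exact nonneg_of_mul_nonneg_right this (by positivity)
  have hcσ : c ^ 2 + σ ^ 2 = 1 := by
    have := norm_smul_add_smul_sq hu1 hw huw c (-σ)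
    rw [neg_smul, ← sub_eq_add_neg, ← hdec, hn.1] at this
    linarith
  have hwn : inner ℝ w n = -σ := by
    rw [hdec, inner_sub_right, inner_smul_right, inner_smul_right, real_inner_comm, huw,
      real_inner_self_eq_norm_sq, hw]
    ring
  have key : ∀ h g : ℝ, r ^ 2 < max h 0 ^ 2 + l ^ 2 → h < g → l * σ ≤ g * c := by
    intro h g hrad hhg
    set ε := l * (g - h) / (g ^ 2 + l ^ 2) with hε
    have hε0 : 0 < ε := by have := sub_pos.2 hhg; positivity
    have hεm : ε * (g ^ 2 + l ^ 2) = l * (g - h) := div_mul_cancel₀ _ (by positivity)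
    have hmem : (q + l • u) + (-l + ε * g) • u + (ε * l) • w ∈ L := by
      refine circularSegment_subset hLcl hL hLint hr hloc hu1 hw huw hl0 (by simpa using hq) ?_ hrad
        (by positivity) ?_
      · rwa [show q + l • u + l • u = q + (2 * l) • u by module, ← hyu, add_sub_cancel]
      · have : ε * (ε * (g ^ 2 + l ^ 2)) = ε * (l * (g - h)) := by rw [hεm]
        have : 0 < ε * (l * (g - h)) := by have := sub_pos.2 hhg; positivity
        nlinarith
    have h1 := hn.2 _ hmem
    rw [show q + l • u + (-l + ε * g) • u + (ε * l) • w - q = ε • (g • u + l • w) by module,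
      inner_smul_left, inner_add_left, inner_smul_left, inner_smul_left, hwn] at h1
    simp only [conj_trivial] at h1
    have := nonneg_of_mul_nonneg_right h1 hε0
    linarith
  have hlrc : l ≤ r * c := by
    rcases lt_or_ge r l with hlt | hle
    · exfalso
      have h1 := key (-2) (-1) (by
        have : (0 : ℝ) ≤ max (-2) 0 ^ 2 := by positivity
        nlinarith) (by norm_num)
      have h2 : 0 ≤ l * σ := by positivity
      have hc' : c = 0 := by linarith
      have hσ' : σ = 0 := by
        have : l * σ = 0 := by linarith
        exact (mul_eq_zero.1 this).resolve_left hl0.ne'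
      rw [hc', hσ'] at hcσ
      norm_num at hcσ
    · have hsq : l ^ 2 ≤ r ^ 2 := by gcongr
      set H := Real.sqrt (r ^ 2 - l ^ 2)
      have hH : H ^ 2 = r ^ 2 - l ^ 2 := Real.sq_sqrt (by linarith)
      have hH0 : 0 ≤ H := Real.sqrt_nonneg _
      have hle' : l * σ ≤ H * c := by
        have hcl : IsClosed {g : ℝ | l * σ ≤ g * c} := isClosed_le (by fun_prop) (by fun_prop)
        have hsub : Ioi H ⊆ {g : ℝ | l * σ ≤ g * c} := by
          intro g hg
          have hg : H < g := hg
          refine key ((H + g) / 2) g ?_ (by linarith)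
          rw [max_eq_left (by linarith)]
          nlinarith
        have := closure_minimal hsub hcl
        rw [closure_Ioi] at this
        exact this self_mem_Ici
      have h1 : (l * σ) ^ 2 ≤ (H * c) ^ 2 := by gcongr
      rw [mul_pow, mul_pow, hH] at h1
      refine le_of_sq_le_sq ?_ (by positivity)
      nlinarith
  rw [hyu, inner_smul_left, norm_smul, hu1, Real.norm_of_nonneg (by positivity), ← hc]
  simp only [conj_trivial]
  nlinarith

/-- Rotations act transitively on the unit sphere in dimension at least `2`. -/
theorem exists_linearIsometryEquiv_det_eq_one [FiniteDimensional ℝ E]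
    (hd : 2 ≤ Module.finrank ℝ E) {n e : E} (hne : ‖n‖ = ‖e‖) :
    ∃ A : E ≃ₗᵢ[ℝ] E, LinearMap.det (A.toLinearEquiv : E →ₗ[ℝ] E) = 1 ∧ A n = e := by
  by_cases h : n = e
  · refine ⟨LinearIsometryEquiv.refl ℝ E, ?_, h⟩
    exact LinearMap.det_id
  · obtain ⟨v, hv, hev⟩ := exists_norm_eq_one_inner_eq_zero hd e
    have hdet : ∀ x : E, x ≠ 0 →
        LinearMap.det (((ℝ ∙ x)ᗮ.reflection).toLinearEquiv : E →ₗ[ℝ] E) = -1 := by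
      intro x hx
      have := Submodule.det_reflection (ℝ ∙ x)ᗮ
      rw [Submodule.orthogonal_orthogonal, finrank_span_singleton hx, pow_one] at this
      exact this
    refine ⟨(ℝ ∙ (n - e))ᗮ.reflection.trans (ℝ ∙ v)ᗮ.reflection, ?_, ?_⟩
    · have hv0 : v ≠ 0 := by
        rintro rfl
        simp at hv
      have := LinearMap.det_comp (((ℝ ∙ v)ᗮ.reflection).toLinearEquiv : E →ₗ[ℝ] E)
        (((ℝ ∙ (n - e))ᗮ.reflection).toLinearEquiv : E →ₗ[ℝ] E)
      rw [hdet v hv0, hdet _ (sub_ne_zero.2 h)] at this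
      norm_num at this
      exact this
    · rw [LinearIsometryEquiv.trans_apply, Submodule.reflection_sub hne]
      exact Submodule.reflection_mem_subspace_eq_self
        (Submodule.mem_orthogonal_singleton_iff_inner_left.2 hev)

/-- Intersections of `K` with properly moved copies of `L` which have interior points and diameter
less than `ε` are centrally symmetric. -/
def SmallIntersectionsSymmetric (K L : Set E) (ε : ℝ) : Prop :=
  ∀ (A : E ≃ₗᵢ[ℝ] E) (v : E), LinearMap.det (A.toLinearEquiv : E →ₗ[ℝ] E) = 1 →
    (interior (K ∩ (fun x => A x + v) '' L)).Nonempty →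
    diam (K ∩ (fun x => A x + v) '' L) < ε →
    ∃ c : E, ∀ x ∈ K ∩ (fun x => A x + v) '' L,
      (2 : ℝ) • c - x ∈ K ∩ (fun x => A x + v) '' L

/-- Every frontier point lies on a ball contained in the set. -/
def HasInnerBalls (K : Set E) : Prop :=
  ∀ q ∈ frontier K, ∃ n : E, ‖n‖ = 1 ∧ ∃ s : ℝ, 0 < s ∧ closedBall (q + s • n) s ⊆ K

/-- If `K` is locally in a ball at `p`, then symmetry of small intersections forces `L` to be
locally congruent to `K` near each of its frontier points. -/
theorem SmallIntersectionsSymmetric.exists_local_congruence {K L : Set E} {ε : ℝ}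
    (hsym : SmallIntersectionsSymmetric K L ε) (hε : 0 < ε) (hK : Convex ℝ K) (hL : Convex ℝ L)
    {p e : E} {R s₁ : ℝ} (hp : p ∈ K) (he : ‖e‖ = 1) (hR : 0 < R) (h : LocallyInBall K p e R)
    (hs₁ : 0 < s₁) (hb₁ : closedBall (p + s₁ • e) s₁ ⊆ K)
    {q n : E} {s₂ : ℝ} (hq : q ∈ frontier L) (hn : ‖n‖ = 1) (hs₂ : 0 < s₂)
    (hb₂ : closedBall (q + s₂ • n) s₂ ⊆ L)
    (A : E ≃ₗᵢ[ℝ] E) (hA : LinearMap.det (A.toLinearEquiv : E →ₗ[ℝ] E) = 1) (hAn : A n = -e) :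
    ∃ δ > 0, ∀ y, ‖y‖ < δ → (q + y ∈ L ↔ p - A y ∈ K) := by
  have hN := isInwardNormal_of_closedBall_subset hL hq hn hs₂ hb₂
  obtain ⟨t₀, ht₀, hcap⟩ := h.exists_cap_small hK hp hR (η := ε / 4) (by positivity)
  obtain ⟨t, ht, htt, hts₁, hts₂⟩ : ∃ t > 0, t ≤ t₀ ∧ t ≤ s₁ ∧ t ≤ s₂ :=
    ⟨min t₀ (min s₁ s₂), by positivity, min_le_left _ _,
      (min_le_right _ _).trans (min_le_left _ _), (min_le_right _ _).trans (min_le_right _ _)⟩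
  have hK₁ : ∀ a r : ℝ, |a - s₁| + r ≤ s₁ → closedBall (p + a • e) r ⊆ K := by
    intro a r har
    refine (closedBall_subset_closedBall' ?_).trans hb₁
    rw [dist_eq_norm, add_sub_add_left_eq_sub, ← sub_smul, norm_smul, he, Real.norm_eq_abs]
    linarith
  have hL₁ : ∀ a r : ℝ, |a - s₂| + r ≤ s₂ → closedBall (q + a • n) r ⊆ L := by
    intro a r har
    refine (closedBall_subset_closedBall' ?_).trans hb₂
    rw [dist_eq_norm, add_sub_add_left_eq_sub, ← sub_smul, norm_smul, hn, Real.norm_eq_abs]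
    linarith
  set M := (fun x => A x + (p + t • e - A q)) '' L with hM
  have hmem : ∀ y, p + t • e + A y ∈ M ↔ q + y ∈ L := by
    intro y
    have : p + t • e + A y = (fun x => A x + (p + t • e - A q)) (q + y) := by
      simp only [map_add]
      abel
    rw [this, hM, Function.Injective.mem_set_image]
    intro a b hab
    exact A.injective (add_right_cancel hab)
  have hrepr : ∀ x, ∃ y, x = p + t • e + A y := fun x =>
    ⟨A.symm (x - (p + t • e)), by simp⟩
  have hSt : ∀ x ∈ K ∩ M, inner ℝ (x - p) e ≤ t := by
    rintro x ⟨-, hx⟩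
    obtain ⟨y, rfl⟩ := hrepr x
    have := hN.2 _ ((hmem y).1 hx)
    rw [add_sub_cancel_left, ← A.inner_map_map, hAn, inner_neg_right] at this
    rw [add_assoc, add_sub_cancel_left, inner_add_left, inner_smul_left,
      real_inner_self_eq_norm_sq, he]
    simp only [conj_trivial]
    linarith
  have hdiam : diam (K ∩ M) < ε := by
    refine (diam_le_of_forall_dist_le (C := ε / 2) (by positivity) ?_).trans_lt (by linarith)
    intro x hx y hy
    have h1 := hcap x hx.1 ((hSt x hx).trans htt)
    have h2 := hcap y hy.1 ((hSt y hy).trans htt)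
    rw [← dist_eq_norm] at h1 h2
    linarith [dist_triangle_right x y p]
  have hint : (interior (K ∩ M)).Nonempty := by
    refine ⟨p + (t / 2) • e, interior_mono (s := ball (p + (t / 2) • e) (t / 2)) ?_ ?_⟩
    · intro x hx
      refine ⟨hK₁ (t / 2) (t / 2) ?_ (ball_subset_closedBall hx), ?_⟩
      · rw [abs_of_nonpos (by linarith)]
        linarith
      · obtain ⟨y, rfl⟩ := hrepr x
        rw [hmem]
        refine hL₁ (t / 2) (t / 2) ?_ (ball_subset_closedBall ?_)
        · rw [abs_of_nonpos (by linarith)]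
          linarith
        · rw [mem_ball, dist_eq_norm] at hx ⊢
          rw [add_sub_add_left_eq_sub, ← A.norm_map, map_sub, map_smul, hAn]
          convert hx using 2
          module
    · rw [interior_eq_iff_isOpen.2 isOpen_ball]
      exact mem_ball_self (by positivity)
  obtain ⟨c, hc⟩ := hsym A _ hA hint hdiam
  have hcp : (2 : ℝ) • c = p + (p + t • e) := by
    have hpS : p ∈ K ∩ M := by
      refine ⟨hp, ?_⟩
      have : p = p + t • e + A (t • n) := by
        rw [map_smul, hAn]
        module
      rw [this, hmem]
      refine hL₁ t 0 ?_ (mem_closedBall_self le_rfl)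
      rw [abs_of_nonpos (by linarith)]
      linarith
    have htS : p + t • e ∈ K ∩ M := by
      refine ⟨hK₁ t 0 ?_ (mem_closedBall_self le_rfl), ?_⟩
      · rw [abs_of_nonpos (by linarith)]
        linarith
      · have := (hmem 0).2 (hL₁ 0 0 (by simp [abs_of_pos hs₂]) (by simp))
        simpa using this
    have h1 := hSt _ (hc p hpS)
    have h2 := h.eq_of_inner_nonpos hK hp hR (hc _ htS).1 (by
      rw [show (2 : ℝ) • c - (p + t • e) - p = (2 : ℝ) • c - p - p - t • e by abel,
        inner_sub_left, inner_smul_left, real_inner_self_eq_norm_sq, he]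
      simp only [conj_trivial]
      linarith)
    exact sub_eq_iff_eq_add.1 h2
  refine ⟨t, ht, fun y hy => ⟨fun hyL => ?_, fun hyK => ?_⟩⟩
  · have hS : p + t • e + A y ∈ K ∩ M := by
      refine ⟨hK₁ t t ?_ ?_, (hmem y).2 hyL⟩
      · rw [abs_of_nonpos (by linarith)]
        linarith
      · rw [mem_closedBall, dist_eq_norm, add_sub_cancel_left, A.norm_map]
        exact hy.le
    have := (hc _ hS).1
    rw [hcp] at this
    convert this using 1
    abel
  · have hS : p - A y ∈ K ∩ M := by
      refine ⟨hyK, ?_⟩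
      have : p - A y = p + t • e + A (t • n - y) := by
        rw [map_sub, map_smul, hAn]
        module
      rw [this, hmem]
      refine hL₁ t t ?_ ?_
      · rw [abs_of_nonpos (by linarith)]
        linarith
      · rw [mem_closedBall, dist_eq_norm, ← add_sub_assoc, sub_right_comm, sub_self, zero_sub,
          norm_neg]
        exact hy.le
    have := (hc _ hS).2
    rw [hcp] at this
    rw [← hmem]
    convert this using 1
    abel

theorem SmallIntersectionsSymmetric.locallyInBall_iff [FiniteDimensional ℝ E]
    (hd : 2 ≤ Module.finrank ℝ E) {K L : Set E} {ε : ℝ}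
    (hsym : SmallIntersectionsSymmetric K L ε) (hε : 0 < ε) (hK : Convex ℝ K) (hL : Convex ℝ L)
    {p e : E} {R s₁ : ℝ} (hp : p ∈ K) (he : ‖e‖ = 1) (hR : 0 < R) (h : LocallyInBall K p e R)
    (hs₁ : 0 < s₁) (hb₁ : closedBall (p + s₁ • e) s₁ ⊆ K)
    {q n : E} {s₂ : ℝ} (hq : q ∈ frontier L) (hn : ‖n‖ = 1) (hs₂ : 0 < s₂)
    (hb₂ : closedBall (q + s₂ • n) s₂ ⊆ L) (r : ℝ) :
    LocallyInBall K p e r ↔ LocallyInBall L q n r := by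
  obtain ⟨A, hA, hAn⟩ := exists_linearIsometryEquiv_det_eq_one hd
    (show ‖n‖ = ‖-e‖ by rw [norm_neg, hn, he])
  obtain ⟨δ, hδ, hiff⟩ :=
    hsym.exists_local_congruence hε hK hL hp he hR h hs₁ hb₁ hq hn hs₂ hb₂ A hA hAn
  have hinner : ∀ y, inner ℝ (-A y) e = inner ℝ y n := by
    intro y
    rw [← A.inner_map_map y n, hAn, inner_neg_left, inner_neg_right]
  constructor
  · rintro ⟨δ', hδ', H⟩
    refine ⟨min δ δ', by positivity, fun y hy hyq => ?_⟩
    obtain ⟨h1, h2⟩ := lt_min_iff.1 hyq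
    have := H (p - A (y - q)) ((hiff _ h1).1 (by rwa [add_sub_cancel]))
    rw [sub_sub_cancel_left, norm_neg, A.norm_map, hinner] at this
    exact this h2
  · rintro ⟨δ', hδ', H⟩
    refine ⟨min δ δ', by positivity, fun x hx hxp => ?_⟩
    obtain ⟨h1, h2⟩ := lt_min_iff.1 hxp
    obtain ⟨y, hy⟩ : ∃ y, x - p = -A y := ⟨-A.symm (x - p), by simp⟩
    rw [hy, norm_neg, A.norm_map] at h1 h2
    have := H (q + y) ((hiff _ h1).2 (by rwa [sub_eq_add_neg, ← hy, add_sub_cancel]))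
    rw [add_sub_cancel_left] at this
    rw [hy, norm_neg, A.norm_map, hinner]
    exact this h2

/-- A point of `L` farthest from `o` gives a ball around `o` supporting `L` from outside. -/
theorem exists_locallyInBall_of_isCompact {L : Set E} (hL : IsCompact L) (hLnt : L.Nontrivial)
    (o : E) : ∃ x ∈ L, ∃ e : E, ‖e‖ = 1 ∧ 0 < ‖x - o‖ ∧ LocallyInBall L x e ‖x - o‖ := by
  obtain ⟨x, hx, hmax⟩ := hL.exists_isMaxOn hLnt.nonempty (f := fun y => ‖y - o‖) (by fun_prop)
  obtain ⟨y, hy, hyo⟩ := hLnt.exists_ne o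
  have hpos : 0 < ‖x - o‖ := (norm_pos_iff.2 (sub_ne_zero.2 hyo)).trans_le (hmax hy)
  have he : ‖‖x - o‖⁻¹ • (o - x)‖ = 1 := by
    rw [norm_smul, norm_inv, norm_norm, norm_sub_rev o x, inv_mul_cancel₀ hpos.ne']
  refine ⟨x, hx, ‖x - o‖⁻¹ • (o - x), he, hpos, 1, one_pos, fun y hy _ => ?_⟩
  rw [← mem_closedBall_add_smul_iff he hpos.le, smul_inv_smul₀ hpos.ne', add_sub_cancel,
    mem_closedBall, dist_eq_norm]
  exact hmax hy

/-- A closed convex body inside a ball, all of whose frontier points lie on the sphere, is the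
ball. -/
theorem eq_closedBall_of_frontier_subset_sphere {L : Set E} (hLcl : IsClosed L)
    (hLint : (interior L).Nonempty) {m : E} {ρ : ℝ} (hρ : 0 < ρ) (hsub : L ⊆ closedBall m ρ)
    (hfr : frontier L ⊆ sphere m ρ) : L = closedBall m ρ := by
  refine hsub.antisymm ?_
  have hball : ball m ρ ⊆ interior L := by
    refine (convex_ball m ρ).isPreconnected.subset_left_of_subset_union isOpen_interior
      hLcl.isOpen_compl (disjoint_compl_right.mono_left interior_subset) ?_ ?_
    · intro x hx
      by_contra hnot
      rw [mem_union, not_or, notMem_compl_iff] at hnot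
      exact (mem_ball.1 hx).ne (hfr ⟨subset_closure hnot.2, hnot.1⟩)
    · obtain ⟨x, hx⟩ := hLint
      refine ⟨x, ?_, hx⟩
      rw [← interior_closedBall m hρ.ne']
      exact interior_mono hsub hx
  rw [← closure_ball m hρ.ne']
  exact closure_minimal (hball.trans interior_subset) hLcl

/-- If `K` is locally in a ball of radius `R` at some point, then symmetry of small intersections
forces `L` to be a ball of radius at most `R`. -/
theorem SmallIntersectionsSymmetric.eq_closedBall [FiniteDimensional ℝ E]
    (hd : 2 ≤ Module.finrank ℝ E) {K L : Set E} {ε : ℝ}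
    (hsym : SmallIntersectionsSymmetric K L ε) (hε : 0 < ε)
    (hK : Convex ℝ K) (hKA : HasInnerBalls K)
    (hLcl : IsClosed L) (hL : Convex ℝ L) (hLint : (interior L).Nonempty) (hLne : L ≠ univ)
    (hLA : HasInnerBalls L) {p e : E} {R : ℝ} (hp : p ∈ K) (he : ‖e‖ = 1) (hR : 0 < R)
    (h : LocallyInBall K p e R) : ∃ ρ, 0 < ρ ∧ ρ ≤ R ∧ ∃ m, L = closedBall m ρ := by
  obtain ⟨e', he', s₁, hs₁, hb₁⟩ := hKA p (h.mem_frontier hK hp he hR)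
  obtain rfl := (h.isInwardNormal hK hp he hR).eq_of_closedBall_subset he' hs₁ hb₁
  have hiff : ∀ {q n : E} {s : ℝ}, q ∈ frontier L → ‖n‖ = 1 → 0 < s →
      closedBall (q + s • n) s ⊆ L → ∀ r, LocallyInBall K p e' r ↔ LocallyInBall L q n r :=
    fun hq hn hs hb =>
      hsym.locallyInBall_iff hd hε hK hL hp he hR h hs₁ hb₁ hq hn hs hb
  choose! n hn s hs hb using hLA
  set W := {r : ℝ | 0 < r ∧ LocallyInBall K p e' r}
  have hRW : R ∈ W := ⟨hR, h⟩
  have hWbdd : BddBelow W := ⟨0, fun r hr => hr.1.le⟩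
  set ρ := sInf W
  have hLin : ∀ q ∈ frontier L, ∀ y ∈ L, ‖y - q‖ ^ 2 ≤ 2 * ρ * inner ℝ (y - q) (n q) := by
    intro q hq y hy
    have hcl : IsClosed {r : ℝ | ‖y - q‖ ^ 2 ≤ 2 * r * inner ℝ (y - q) (n q)} :=
      isClosed_le (by fun_prop) (by fun_prop)
    refine closure_minimal (s := W) ?_ hcl (csInf_mem_closure ⟨R, hRW⟩ hWbdd)
    rintro r ⟨hr, hrW⟩
    exact norm_sub_sq_le_of_locallyInBall hd hLcl hL hLint hr
      (fun q hq => ⟨n q, hn q hq, (hiff hq (hn q hq) (hs q hq) (hb q hq) r).1 hrW⟩)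
      (hLcl.frontier_subset hq)
      (isInwardNormal_of_closedBall_subset hL hq (hn q hq) (hs q hq) (hb q hq)) hy
  have : Nontrivial E := Module.nontrivial_of_finrank_pos (R := ℝ) (by omega)
  obtain ⟨q₀, hq₀⟩ : (frontier L).Nonempty :=
    nonempty_frontier_iff.2 ⟨hLint.mono interior_subset, hLne⟩
  have hq₀' : q₀ + s q₀ • n q₀ ∈ L := hb q₀ hq₀ (mem_closedBall_self (hs q₀ hq₀).le)
  have hρ : 0 < ρ := by
    have h1 := hLin q₀ hq₀ _ hq₀'
    have h2 := hs q₀ hq₀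
    rw [add_sub_cancel_left, norm_smul, hn q₀ hq₀, inner_smul_left, real_inner_self_eq_norm_sq,
      hn q₀ hq₀, Real.norm_of_nonneg h2.le] at h1
    simp only [conj_trivial] at h1
    by_contra! hle
    nlinarith [mul_nonneg h2.le (neg_nonneg.2 hle), sq_pos_of_pos h2]
  have hLball : ∀ q ∈ frontier L, L ⊆ closedBall (q + ρ • n q) ρ := fun q hq y hy =>
    (mem_closedBall_add_smul_iff (hn q hq) hρ.le q y).2 (hLin q hq y hy)
  have hLcpt : IsCompact L := (isCompact_closedBall _ _).of_isClosed_subset hLcl (hLball q₀ hq₀)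
  have hLnt : L.Nontrivial := by
    refine ⟨q₀, hLcl.frontier_subset hq₀, _, hq₀', ?_⟩
    intro heq
    have h1 : s q₀ • n q₀ = 0 := left_eq_add.1 heq
    have h2 := congrArg norm h1
    rw [norm_smul, hn q₀ hq₀, norm_zero, mul_one] at h2
    exact (hs q₀ hq₀).ne' (norm_eq_zero.1 h2)
  have hcentre : ∀ q ∈ frontier L, q + ρ • n q = q₀ + ρ • n q₀ := by
    intro q hq
    by_contra hne
    set m₁ := q + ρ • n q
    set m₂ := q₀ + ρ • n q₀
    obtain ⟨x, hx, f, hf, hpos, hloc⟩ := exists_locallyInBall_of_isCompact hLcpt hLnt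
      ((1 / 2 : ℝ) • (m₁ + m₂))
    have hxfr := hloc.mem_frontier hL hx hf hpos
    obtain rfl := (hloc.isInwardNormal hL hx hf hpos).eq_of_closedBall_subset (hn x hxfr)
      (hs x hxfr) (hb x hxfr)
    have hmem : ‖x - (1 / 2 : ℝ) • (m₁ + m₂)‖ ∈ W :=
      ⟨hpos, (hiff hxfr (hn x hxfr) (hs x hxfr) (hb x hxfr) _).2 hloc⟩
    have hge : ρ ≤ ‖x - (1 / 2 : ℝ) • (m₁ + m₂)‖ := csInf_le hWbdd hmem
    have h1 := mem_closedBall_iff_norm.1 (hLball q hq hx)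
    have h2 := mem_closedBall_iff_norm.1 (hLball q₀ hq₀ hx)
    change ‖x - m₁‖ ≤ ρ at h1
    change ‖x - m₂‖ ≤ ρ at h2
    have hpar := parallelogram_law_with_norm ℝ (x - m₁) (x - m₂)
    rw [show x - m₁ + (x - m₂) = (2 : ℝ) • (x - (1 / 2 : ℝ) • (m₁ + m₂)) by module,
      sub_sub_sub_cancel_left, norm_smul, Real.norm_two] at hpar
    have h3 : 0 < ‖m₂ - m₁‖ := norm_pos_iff.2 (sub_ne_zero.2 (Ne.symm hne))
    have h4 : ‖x - m₁‖ * ‖x - m₁‖ ≤ ρ * ρ := by gcongr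
    have h5 : ‖x - m₂‖ * ‖x - m₂‖ ≤ ρ * ρ := by gcongr
    have h6 := mul_le_mul hge hge hρ.le (norm_nonneg _)
    nlinarith [mul_pos h3 h3]
  refine ⟨ρ, hρ, csInf_le hWbdd hRW, q₀ + ρ • n q₀,
    eq_closedBall_of_frontier_subset_sphere hLcl hLint hρ (hLball q₀ hq₀) fun q hq => ?_⟩
  rw [mem_sphere, ← hcentre q hq, dist_eq_norm, sub_add_cancel_left, norm_neg, norm_smul, hn q hq,
    Real.norm_of_nonneg hρ.le, mul_one]

end InnerProductSpace

theorem CondA.hasInnerBalls {d : ℕ} {K : Set (Euc d)} (h : CondA K) : HasInnerBalls K := by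
  intro q hq
  obtain ⟨s, hs, c, hc, hb⟩ := h q hq
  rw [dist_comm, dist_eq_norm] at hc
  refine ⟨s⁻¹ • (c - q), ?_, s, hs, ?_⟩
  · rw [norm_smul, hc, Real.norm_of_nonneg (inv_nonneg.2 hs.le), inv_mul_cancel₀ hs.ne']
  · rwa [smul_inv_smul₀ hs.ne', add_sub_cancel]

theorem HasExtremePoint.exists_locallyInBall {d : ℕ} (hd : 2 ≤ d) {K : Set (Euc d)}
    (h : HasExtremePoint K) (hKcl : IsClosed K) (hK : Convex ℝ K)
    (hKint : (interior K).Nonempty) :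
    ∃ p ∈ K, ∃ e : Euc d, ‖e‖ = 1 ∧ ∃ r > 0, LocallyInBall K p e r := by
  obtain ⟨x, hx, hext⟩ := h
  have : Nontrivial (Euc d) := Module.nontrivial_of_finrank_pos (R := ℝ) (by
    rw [finrank_euclideanSpace_fin]
    omega)
  have hne : ∃ z ∈ K, z ≠ x := by
    by_contra! hsub
    have := interior_mono (show K ⊆ {x} from hsub)
    rw [interior_singleton] at this
    exact (hKint.mono this).ne_empty rfl
  obtain ⟨z, hz, hzx⟩ := hne
  refine exists_locallyInBall_of_mem_extremePoints hKcl hK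
    (mem_extremePoints_iff_left.2 ⟨hx, fun y hy z hz hmem => ?_⟩) hz hzx
  by_cases hyz : y = z
  · rw [← hyz, openSegment_same] at hmem
    exact (mem_singleton_iff.1 hmem).symm
  · exact absurd hmem (hext y hy z hz hyz)

/-- It suffices to know the symmetry of small intersections for affine isometries. -/
theorem smallIntersectionsSymmetric_of_forall {d : ℕ} {K L : Set (Euc d)} {ε : ℝ}
    (h : ∀ ψ : Euc d ≃ᵃⁱ[ℝ] Euc d, OrientationPreserving ψ →
      (interior (K ∩ ψ '' L)).Nonempty → diam (K ∩ ψ '' L) < ε →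
      CentrallySymmetric (K ∩ ψ '' L)) : SmallIntersectionsSymmetric K L ε := by
  intro A v hA hint hdiam
  obtain ⟨c, hc⟩ := h (AffineIsometryEquiv.mk' (fun x => A x + v) A 0 fun x => by simp)
    (by rwa [OrientationPreserving, AffineIsometryEquiv.linearIsometryEquiv_mk']) hint hdiam
  refine ⟨c, fun x hx => ?_⟩
  exact hc.subset (mem_image_of_mem _ hx)

theorem orientationPreserving_refl (d : ℕ) :
    OrientationPreserving (AffineIsometryEquiv.refl ℝ (Euc d)) :=
  LinearMap.det_id

theorem centrallySymmetric_closedBall_inter_closedBall {d : ℕ} (c c' : Euc d) (r : ℝ) :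
    CentrallySymmetric (closedBall c r ∩ closedBall c' r) := by
  refine ⟨(1 / 2 : ℝ) • (c + c'), ?_⟩
  have hmaps : ∀ x ∈ closedBall c r ∩ closedBall c' r,
      (2 : ℝ) • (1 / 2 : ℝ) • (c + c') - x ∈ closedBall c r ∩ closedBall c' r := by
    rintro x ⟨h1, h2⟩
    rw [mem_closedBall_iff_norm'] at h1 h2
    rw [show (2 : ℝ) • (1 / 2 : ℝ) • (c + c') - x = c + c' - x by module]
    refine ⟨?_, ?_⟩ <;> rw [mem_closedBall_iff_norm]
    · convert h2 using 2
      abel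
    · convert h1 using 2
      abel
  refine (image_subset_iff.2 hmaps).antisymm fun x hx => ⟨_, hmaps x hx, sub_sub_cancel _ _⟩

/-- If a set with an extreme point has symmetric small intersections with another one in both
orders, then both are balls of the same radius. -/
theorem exists_closedBall_of_smallIntersectionsSymmetric {d : ℕ} (hd : 2 ≤ d) {K L : Set (Euc d)}
    {ε : ℝ} (hε : 0 < ε) (hKL : SmallIntersectionsSymmetric K L ε)
    (hLK : SmallIntersectionsSymmetric L K ε)
    (hKcl : IsClosed K) (hK : Convex ℝ K) (hKint : (interior K).Nonempty) (hKne : K ≠ univ)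
    (hLcl : IsClosed L) (hL : Convex ℝ L) (hLint : (interior L).Nonempty) (hLne : L ≠ univ)
    (hKA : CondA K) (hLA : CondA L) (hext : HasExtremePoint K) :
    ∃ r : ℝ, 0 < r ∧ ∃ c c' : Euc d, K = closedBall c r ∧ L = closedBall c' r := by
  have hd' : 2 ≤ Module.finrank ℝ (Euc d) := by rwa [finrank_euclideanSpace_fin]
  have : Nontrivial (Euc d) := Module.nontrivial_of_finrank_pos (R := ℝ) (by omega)
  have hball : ∀ (m : Euc d) {ρ : ℝ}, 0 < ρ → ∃ p ∈ closedBall m ρ, ∃ e : Euc d, ‖e‖ = 1 ∧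
      LocallyInBall (closedBall m ρ) p e ρ := by
    intro m ρ hρ
    obtain ⟨e, he⟩ := exists_norm_eq (Euc d) zero_le_one
    refine ⟨m - ρ • e, ?_, e, he, 1, one_pos, fun y hy _ => ?_⟩
    · rw [mem_closedBall_iff_norm, sub_sub_cancel_left, norm_neg, norm_smul, he,
        Real.norm_of_nonneg hρ.le, mul_one]
    · rwa [← mem_closedBall_add_smul_iff he hρ.le, sub_add_cancel]
  obtain ⟨p, hp, e, he, R, hR, h⟩ := hext.exists_locallyInBall hd hKcl hK hKint
  obtain ⟨ρ, hρ, -, m, rfl⟩ := hKL.eq_closedBall hd' hε hK hKA.hasInnerBalls hLcl hL hLint hLne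
    hLA.hasInnerBalls hp he hR h
  obtain ⟨p₁, hp₁, e₁, he₁, h₁⟩ := hball m hρ
  obtain ⟨r, hr, hrρ, c, rfl⟩ := hLK.eq_closedBall hd' hε hL hLA.hasInnerBalls hKcl hK hKint hKne
    hKA.hasInnerBalls hp₁ he₁ hρ h₁
  obtain ⟨p₂, hp₂, e₂, he₂, h₂⟩ := hball c hr
  obtain ⟨ρ', hρ', hρr, m', heq⟩ := hKL.eq_closedBall hd' hε hK hKA.hasInnerBalls hLcl hL hLint
    hLne hLA.hasInnerBalls hp₂ he₂ hr h₂
  have hdiam := congrArg diam heq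
  rw [diam_closedBall_eq _ hρ.le, diam_closedBall_eq _ hρ'.le] at hdiam
  obtain rfl : ρ = r := by linarith
  exact ⟨ρ, hρ, c, m, rfl, rfl⟩

/-- Theorem 1 (Euclidean case): small intersections of congruent copies centrally
symmetric iff `K` and `L` are congruent balls. -/
theorem small_intersections_centrally_symmetric_iff_congruent_balls
    (d : ℕ) (hd : 2 ≤ d) (K L : Set (Euc d))
    (hKcl : IsClosed K) (hKconv : Convex ℝ K) (hKint : (interior K).Nonempty)
    (hKne : K ≠ univ)
    (hLcl : IsClosed L) (hLconv : Convex ℝ L) (hLint : (interior L).Nonempty)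
    (hLne : L ≠ univ)
    (hKA : CondA K) (hLA : CondA L)
    (hext : HasExtremePoint K ∨ HasExtremePoint L) :
    (∃ ε : ℝ, 0 < ε ∧ ∀ φ ψ : Euc d ≃ᵃⁱ[ℝ] Euc d,
        OrientationPreserving φ → OrientationPreserving ψ →
        (interior (φ '' K ∩ ψ '' L)).Nonempty → diam (φ '' K ∩ ψ '' L) < ε →
        CentrallySymmetric (φ '' K ∩ ψ '' L)) ↔
    (∃ r : ℝ, 0 < r ∧ ∃ c c' : Euc d, K = closedBall c r ∧ L = closedBall c' r) := by
  constructor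
  · rintro ⟨ε, hε, H⟩
    have hKL : SmallIntersectionsSymmetric K L ε := smallIntersectionsSymmetric_of_forall
      fun ψ hψ => by simpa using H (.refl ℝ _) ψ (orientationPreserving_refl d) hψ
    have hLK : SmallIntersectionsSymmetric L K ε := smallIntersectionsSymmetric_of_forall
      fun ψ hψ => by simpa [inter_comm] using H ψ (.refl ℝ _) hψ (orientationPreserving_refl d)
    rcases hext with hext | hext
    · exact exists_closedBall_of_smallIntersectionsSymmetric hd hε hKL hLK hKcl hKconv hKint hKne
        hLcl hLconv hLint hLne hKA hLA hext
    · obtain ⟨r, hr, c, c', hL, hK⟩ := exists_closedBall_of_smallIntersectionsSymmetric hd hε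
        hLK hKL hLcl hLconv hLint hLne hKcl hKconv hKint hKne hLA hKA hext
      exact ⟨r, hr, c', c, hK, hL⟩
  · rintro ⟨r, -, c, c', rfl, rfl⟩
    refine ⟨1, one_pos, fun φ ψ _ _ _ _ => ?_⟩
    have himage : ∀ (φ : Euc d ≃ᵃⁱ[ℝ] Euc d) (c : Euc d),
        φ '' closedBall c r = closedBall (φ c) r :=
      fun φ c => φ.toIsometryEquiv.image_closedBall c r
    rw [himage, himage]
    exact centrallySymmetric_closedBall_inter_closedBall _ _ _
end
end
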